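/- arXiv:2409.20468 — 5 statements merged into one kernel-verified Lean document; each statement's English description precedes it below -/
import Mathlib

section
/- Let λ ≥ 1, μ ≥ 0, h_s > 0, T > 0, and let x : [0,h_s] × [0,T] → ℝ be a C² function satisfying ∂_t²x(y,t) + μ·x(y,t) = λ·∂_y²x(y,t) on [0,h_s] × [0,T] and x(0,t) = 0 for all t ∈ [0,T]. Then μ·∫₀^T x(h_s,t)² dt ≤ 2(1+λ)·∫₀^T ((∂_t x(h_s,t))² + λ(∂_y x(h_s,t))²) dt + 2∫₀^{h_s} ((∂_t x)² + μ·x² + λ(∂_y x)²)(y,0) dy. In other words, the time-integrated boundary value of the mode, weighted by μ, is controlled by time-integrated boundary values of the time derivative and normal derivative, plus the initial mode energy. -/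
open Set MeasureTheory in
/-- The flux through the boundary of a rectangle of a `C¹` vector field that is
divergence-free on that rectangle vanishes. -/
theorem integral_boundary_eq_zero_of_divergence_eq_zero {f g : ℝ × ℝ → ℝ}
    (hf : ContDiff ℝ 1 f) (hg : ContDiff ℝ 1 g) {a b : ℝ} (ha : 0 ≤ a) (hb : 0 ≤ b)
    (hdiv : ∀ p ∈ Icc 0 a ×ˢ Icc 0 b, fderiv ℝ f p (1, 0) + fderiv ℝ g p (0, 1) = 0) :
    (∫ y in (0:ℝ)..a, g (y, b)) - (∫ y in (0:ℝ)..a, g (y, 0))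
      + (∫ t in (0:ℝ)..b, f (a, t)) - (∫ t in (0:ℝ)..b, f (0, t)) = 0 := by
  have hdiv' : ∀ p ∈ uIcc 0 a ×ˢ uIcc 0 b,
      fderiv ℝ f p (1, 0) + fderiv ℝ g p (0, 1) = 0 := by
    rwa [uIcc_of_le ha, uIcc_of_le hb]
  rw [← integral2_divergence_prod_of_hasFDerivAt f g (fderiv ℝ f) (fderiv ℝ g) 0 0 a b
    hf.continuous.continuousOn hg.continuous.continuousOn
    (fun p _ => (hf.differentiable one_ne_zero p).hasFDerivAt)
    (fun p _ => (hg.differentiable one_ne_zero p).hasFDerivAt)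
    (integrableOn_zero.congr_fun (fun p hp => (hdiv' p hp).symm)
      (measurableSet_uIcc.prod measurableSet_uIcc))]
  refine (intervalIntegral.integral_congr fun y hy => ?_).trans intervalIntegral.integral_zero
  exact (intervalIntegral.integral_congr fun t ht => hdiv' (y, t) ⟨hy, ht⟩).trans
    intervalIntegral.integral_zero

theorem hasDerivAt_fst_of_differentiableAt {f : ℝ × ℝ → ℝ} {y t : ℝ}
    (hf : DifferentiableAt ℝ f (y, t)) :
    HasDerivAt (fun s => f (s, t)) (fderiv ℝ f (y, t) (1, 0)) y :=
  HasFDerivAt.comp_hasDerivAt (l := f) (f := fun s => (s, t)) y hf.hasFDerivAt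
    ((hasDerivAt_id y).prodMk (hasDerivAt_const y t))

theorem hasDerivAt_snd_of_differentiableAt {f : ℝ × ℝ → ℝ} {y t : ℝ}
    (hf : DifferentiableAt ℝ f (y, t)) :
    HasDerivAt (fun r => f (y, r)) (fderiv ℝ f (y, t) (0, 1)) t :=
  HasFDerivAt.comp_hasDerivAt (l := f) (f := fun r => (y, r)) t hf.hasFDerivAt
    ((hasDerivAt_const t y).prodMk (hasDerivAt_id t))

/-- per-mode dissipative estimate: the time-integrated boundary
value of the mode, weighted by `μ`, is controlled by time-integrated boundary
values of the time derivative and normal derivative, plus the initial mode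
energy. -/
theorem stmt_2
    (lam mu hs T : ℝ) (hlam : 1 ≤ lam) (hmu : 0 ≤ mu) (hhs : 0 < hs) (hT : 0 < T)
    (x : ℝ → ℝ → ℝ)
    (hx : ContDiff ℝ 2 (fun p : ℝ × ℝ => x p.1 p.2))
    (hpde : ∀ y ∈ Set.Icc (0:ℝ) hs, ∀ t ∈ Set.Icc (0:ℝ) T,
      deriv (deriv (x y)) t + mu * x y t
        = lam * deriv (fun s => deriv (fun r => x r t) s) y)
    (hdir : ∀ t ∈ Set.Icc (0:ℝ) T, x 0 t = 0) :
    mu * ∫ t in (0:ℝ)..T, (x hs t) ^ 2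
      ≤ 2 * (1 + lam) * (∫ t in (0:ℝ)..T,
            ((deriv (x hs) t) ^ 2 + lam * (deriv (fun s => x s t) hs) ^ 2))
        + 2 * ∫ y in (0:ℝ)..hs,
            ((deriv (x y) 0) ^ 2 + mu * (x y 0) ^ 2
              + lam * (deriv (fun s => x s 0) y) ^ 2) := by
  set u : ℝ × ℝ → ℝ := fun p => x p.1 p.2 with hu
  set a : ℝ × ℝ → ℝ := fun p => fderiv ℝ u p (1, 0) with ha
  set b : ℝ × ℝ → ℝ := fun p => fderiv ℝ u p (0, 1) with hb
  have hdu : ContDiff ℝ 1 (fderiv ℝ u) := hx.fderiv_right (by norm_num)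
  have hu1 : ContDiff ℝ 1 u := hx.of_le (by norm_num)
  have ha1 : ContDiff ℝ 1 a := hdu.clm_apply contDiff_const
  have hb1 : ContDiff ℝ 1 b := hdu.clm_apply contDiff_const
  have hud := hu1.differentiable one_ne_zero
  have had := ha1.differentiable one_ne_zero
  have hbd := hb1.differentiable one_ne_zero
  have hxa : ∀ y t, deriv (fun s => x s t) y = a (y, t) := fun y t =>
    (hasDerivAt_fst_of_differentiableAt (hud (y, t))).deriv
  have hxb : ∀ y t, deriv (x y) t = b (y, t) := fun y t =>
    (hasDerivAt_snd_of_differentiableAt (hud (y, t))).deriv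
  have hwave : ∀ p ∈ Set.Icc 0 hs ×ˢ Set.Icc 0 T,
      fderiv ℝ b p (0, 1) + mu * u p = lam * fderiv ℝ a p (1, 0) := by
    rintro ⟨y, t⟩ ⟨hy, ht⟩
    have h := hpde y hy t ht
    simp only [hxa] at h
    rwa [show deriv (x y) = fun r => b (y, r) from funext (hxb y),
      (hasDerivAt_snd_of_differentiableAt (hbd (y, t))).deriv,
      (hasDerivAt_fst_of_differentiableAt (had (y, t))).deriv] at h
  have hsymm : ∀ p, fderiv ℝ a p (0, 1) = fderiv ℝ b p (1, 0) := by
    intro p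
    have hd : DifferentiableAt ℝ (fderiv ℝ u) p := hdu.differentiable one_ne_zero p
    have h := (hx.contDiffAt (x := p)).isSymmSndFDerivAt (by simp) (1, 0) (0, 1)
    rw [ha, hb, fderiv_clm_apply hd (differentiableAt_const _),
      fderiv_clm_apply hd (differentiableAt_const _)]
    simpa using h.symm
  have hb0 : ∀ t ∈ Set.Icc 0 T, b (0, t) = 0 := by
    intro t ht
    have h := (hasDerivAt_snd_of_differentiableAt (hud (0, t))).hasDerivWithinAt (s := Set.Icc 0 T)
    change fderiv ℝ u (0, t) (0, 1) = 0
    rw [← h.derivWithin (uniqueDiffOn_Icc hT t ht),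
      derivWithin_congr (f := fun _ => (0:ℝ)) hdir (hdir t ht)]
    simp
  have huc := hu1.continuous
  have hac := ha1.continuous
  have hbc := hb1.continuous
  have hmomentum := integral_boundary_eq_zero_of_divergence_eq_zero
    (f := fun p => mu * u p ^ 2 - b p ^ 2 - lam * a p ^ 2) (g := fun p => 2 * (a p * b p))
    (by fun_prop) (by fun_prop) hhs.le hT.le (by
      intro p hp
      have hf := ((((hud p).hasFDerivAt.pow 2).const_mul mu).sub
        ((hbd p).hasFDerivAt.pow 2)).sub (((had p).hasFDerivAt.pow 2).const_mul lam)
      have hg := ((had p).hasFDerivAt.mul (hbd p).hasFDerivAt).const_mul 2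
      refine (congrArg₂ (fun A B : ℝ × ℝ →L[ℝ] ℝ => A (1, 0) + B (0, 1))
        hf.fderiv hg.fderiv).trans ?_
      have ha' : fderiv ℝ u p (1, 0) = a p := rfl
      simp [ha', hsymm]
      linear_combination 2 * a p * hwave p hp)
  have henergy := integral_boundary_eq_zero_of_divergence_eq_zero
    (f := fun p => (-2 * lam) * (a p * b p))
    (g := fun p => b p ^ 2 + mu * u p ^ 2 + lam * a p ^ 2)
    (by fun_prop) (by fun_prop) hhs.le hT.le (by
      intro p hp
      have hf := ((had p).hasFDerivAt.mul (hbd p).hasFDerivAt).const_mul (-2 * lam)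
      have hg := (((hbd p).hasFDerivAt.pow 2).add
        (((hud p).hasFDerivAt.pow 2).const_mul mu)).add
        (((had p).hasFDerivAt.pow 2).const_mul lam)
      refine (congrArg₂ (fun A B : ℝ × ℝ →L[ℝ] ℝ => A (1, 0) + B (0, 1))
        hf.fderiv hg.fderiv).trans ?_
      have hb' : fderiv ℝ u p (0, 1) = b p := rfl
      simp [hb', hsymm]
      linear_combination 2 * b p * hwave p hp)
  simp only [hxa, hxb]
  have hlam0 : 0 ≤ lam := by linarith
  have hcross : ∀ p, |2 * (a p * b p)| ≤ b p ^ 2 + mu * u p ^ 2 + lam * a p ^ 2 := by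
    intro p
    have h1 : 0 ≤ mu * u p ^ 2 := by positivity
    have h2 : 0 ≤ (lam - 1) * a p ^ 2 := mul_nonneg (by linarith) (sq_nonneg _)
    rw [abs_le]
    constructor <;> nlinarith [sq_nonneg (a p - b p), sq_nonneg (a p + b p)]
  have hbdry_split : (∫ t in (0:ℝ)..T, (mu * u (hs, t) ^ 2 - b (hs, t) ^ 2 - lam * a (hs, t) ^ 2))
      = mu * (∫ t in (0:ℝ)..T, x hs t ^ 2)
        - ∫ t in (0:ℝ)..T, (b (hs, t) ^ 2 + lam * a (hs, t) ^ 2) := by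
    rw [← intervalIntegral.integral_const_mul, ← intervalIntegral.integral_sub]
    · exact intervalIntegral.integral_congr fun t _ => by simp only [hu]; ring
    · exact Continuous.intervalIntegrable
        (show Continuous fun t => mu * u (hs, t) ^ 2 by fun_prop) _ _
    · exact Continuous.intervalIntegrable (by fun_prop) _ _
  have hbottom : (∫ t in (0:ℝ)..T, (mu * u (0, t) ^ 2 - b (0, t) ^ 2 - lam * a (0, t) ^ 2)) ≤ 0 := by
    rw [← neg_nonneg, ← intervalIntegral.integral_neg]
    refine intervalIntegral.integral_nonneg hT.le fun t ht => ?_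
    have h : u (0, t) = 0 := hdir t ht
    rw [h]
    nlinarith [sq_nonneg (b (0, t)), mul_nonneg hlam0 (sq_nonneg (a (0, t)))]
  have hbottom_flux : (∫ t in (0:ℝ)..T, (-2 * lam) * (a (0, t) * b (0, t))) = 0 :=
    (intervalIntegral.integral_congr fun t ht => by
      rw [Set.uIcc_of_le hT.le] at ht
      simp [hb0 t ht]).trans intervalIntegral.integral_zero
  have hfinal : -(∫ y in (0:ℝ)..hs, 2 * (a (y, T) * b (y, T)))
      ≤ ∫ y in (0:ℝ)..hs, (b (y, T) ^ 2 + mu * u (y, T) ^ 2 + lam * a (y, T) ^ 2) := by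
    rw [← intervalIntegral.integral_neg]
    exact intervalIntegral.integral_mono_on hhs.le
      (Continuous.intervalIntegrable (by fun_prop) _ _)
      (Continuous.intervalIntegrable (by fun_prop) _ _)
      fun y _ => (neg_le_abs _).trans (hcross (y, T))
  have hinitial : (∫ y in (0:ℝ)..hs, 2 * (a (y, 0) * b (y, 0)))
      ≤ ∫ y in (0:ℝ)..hs, (b (y, 0) ^ 2 + mu * u (y, 0) ^ 2 + lam * a (y, 0) ^ 2) :=
    intervalIntegral.integral_mono_on hhs.le
      (Continuous.intervalIntegrable (by fun_prop) _ _)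
      (Continuous.intervalIntegrable (by fun_prop) _ _)
      fun y _ => (le_abs_self _).trans (hcross (y, 0))
  have htop_flux : -(∫ t in (0:ℝ)..T, (-2 * lam) * (a (hs, t) * b (hs, t)))
      ≤ lam * ∫ t in (0:ℝ)..T, (b (hs, t) ^ 2 + lam * a (hs, t) ^ 2) := by
    rw [← intervalIntegral.integral_neg, ← intervalIntegral.integral_const_mul]
    refine intervalIntegral.integral_mono_on hT.le
      (Continuous.intervalIntegrable (by fun_prop) _ _)
      (Continuous.intervalIntegrable (by fun_prop) _ _) fun t _ => ?_
    have h1 : 0 ≤ (lam - 1) * a (hs, t) ^ 2 := mul_nonneg (by linarith) (sq_nonneg _)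
    have h2 := mul_nonneg hlam0 h1
    nlinarith [mul_nonneg hlam0 (sq_nonneg (a (hs, t) - b (hs, t)))]
  have hbdry_nonneg : 0 ≤ ∫ t in (0:ℝ)..T, (b (hs, t) ^ 2 + lam * a (hs, t) ^ 2) :=
    intervalIntegral.integral_nonneg hT.le fun t _ => by positivity
  have hscaled := mul_nonneg hlam0 hbdry_nonneg
  have hinitial_energy :
      (∫ y in (0:ℝ)..hs, (b (y, 0) ^ 2 + mu * x y 0 ^ 2 + lam * a (y, 0) ^ 2))
        = ∫ y in (0:ℝ)..hs, (b (y, 0) ^ 2 + mu * u (y, 0) ^ 2 + lam * a (y, 0) ^ 2) := rfl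
  rw [hinitial_energy]
  linarith
end

section
/- Let λ > 0, μ ≥ 0, h_s > 0, T > 0, and let x : [0,h_s] × [0,T] → ℝ be a C² function satisfying ∂_t²x(y,t) + μ·x(y,t) = λ·∂_y²x(y,t) on [0,h_s] × [0,T] and x(0,t) = 0 for all t ∈ [0,T]. Then ∫₀^{h_s} ((∂_t x)² + λ(∂_y x)²)(y,T) dy ≤ ∫₀^{h_s} ((∂_t x)² + μ·x² + λ(∂_y x)²)(y,0) dy + λ∫₀^T ((∂_y x(h_s,t))² + (∂_t x(h_s,t))²) dt. -/
open MeasureTheory intervalIntegral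

theorem DifferentiableAt.hasDerivAt_fst_slice {w : ℝ × ℝ → ℝ} {y t : ℝ}
    (hw : DifferentiableAt ℝ w (y, t)) :
    HasDerivAt (fun s => w (s, t)) (fderiv ℝ w (y, t) (1, 0)) y :=
  hw.hasFDerivAt.comp_hasDerivAt (f := fun s => (s, t)) y
    ((hasDerivAt_id y).prodMk (hasDerivAt_const y t))

theorem DifferentiableAt.hasDerivAt_snd_slice {w : ℝ × ℝ → ℝ} {y t : ℝ}
    (hw : DifferentiableAt ℝ w (y, t)) :
    HasDerivAt (fun s => w (y, s)) (fderiv ℝ w (y, t) (0, 1)) t :=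
  hw.hasFDerivAt.comp_hasDerivAt (f := fun s => (y, s)) t
    ((hasDerivAt_const t y).prodMk (hasDerivAt_id t))

/-- Symmetry of the second partial derivatives of a `C²` function. -/
theorem ContDiff.fderiv_fst_snd_comm {u : ℝ × ℝ → ℝ} (hu : ContDiff ℝ 2 u) (p : ℝ × ℝ) :
    fderiv ℝ (fun q => fderiv ℝ u q (1, 0)) p (0, 1)
      = fderiv ℝ (fun q => fderiv ℝ u q (0, 1)) p (1, 0) := by
  have hd : DifferentiableAt ℝ (fderiv ℝ u) p :=
    (hu.fderiv_right (m := 1) (by norm_num)).differentiable (by norm_num) p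
  have hsymm := (hu.contDiffAt (x := p)).isSymmSndFDerivAt (by simp)
  rw [fderiv_clm_apply hd (by fun_prop), fderiv_clm_apply hd (by fun_prop)]
  simpa using hsymm (0, 1) (1, 0)

/-- the mode energy at time `T` is controlled by the initial mode
energy plus the time-integrated boundary values of the normal and time
derivatives. -/
theorem stmt_3
    (lam mu hs T : ℝ) (hlam : 0 < lam) (hmu : 0 ≤ mu) (hhs : 0 < hs) (hT : 0 < T)
    (x : ℝ → ℝ → ℝ)
    (hx : ContDiff ℝ 2 (fun p : ℝ × ℝ => x p.1 p.2))
    (hpde : ∀ y ∈ Set.Icc (0:ℝ) hs, ∀ t ∈ Set.Icc (0:ℝ) T,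
      deriv (deriv (x y)) t + mu * x y t
        = lam * deriv (fun s => deriv (fun r => x r t) s) y)
    (hdir : ∀ t ∈ Set.Icc (0:ℝ) T, x 0 t = 0) :
    (∫ y in (0:ℝ)..hs,
        ((deriv (x y) T) ^ 2 + lam * (deriv (fun s => x s T) y) ^ 2))
      ≤ (∫ y in (0:ℝ)..hs,
          ((deriv (x y) 0) ^ 2 + mu * (x y 0) ^ 2
            + lam * (deriv (fun s => x s 0) y) ^ 2))
        + lam * ∫ t in (0:ℝ)..T,
            ((deriv (fun s => x s t) hs) ^ 2 + (deriv (x hs) t) ^ 2) := by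
  set u : ℝ × ℝ → ℝ := fun p => x p.1 p.2
  set P : ℝ × ℝ → ℝ := fun p => fderiv ℝ u p (1, 0)
  set Q : ℝ × ℝ → ℝ := fun p => fderiv ℝ u p (0, 1)
  have hDu : ContDiff ℝ 1 (fderiv ℝ u) := hx.fderiv_right (by norm_num)
  have hPc : ContDiff ℝ 1 P := hDu.clm_apply contDiff_const
  have hQc : ContDiff ℝ 1 Q := hDu.clm_apply contDiff_const
  have hud : Differentiable ℝ u := hx.differentiable (by norm_num)
  have hPd : Differentiable ℝ P := hPc.differentiable (by norm_num)
  have hQd : Differentiable ℝ Q := hQc.differentiable (by norm_num)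
  have huc : Continuous u := hx.continuous
  have hPcont : Continuous P := hPc.continuous
  have hQcont : Continuous Q := hQc.continuous
  have hderiv_fst (y t : ℝ) : deriv (fun s => x s t) y = P (y, t) :=
    (hud (y, t)).hasDerivAt_fst_slice.deriv
  have hderiv_snd (y t : ℝ) : deriv (x y) t = Q (y, t) :=
    (hud (y, t)).hasDerivAt_snd_slice.deriv
  have hwave : ∀ y ∈ Set.Icc 0 hs, ∀ t ∈ Set.Icc 0 T,
      fderiv ℝ Q (y, t) (0, 1) + mu * u (y, t) = lam * fderiv ℝ P (y, t) (1, 0) := by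
    intro y hy t ht
    have h := hpde y hy t ht
    simp only [hderiv_fst, funext (hderiv_snd y)] at h
    rwa [(hPd (y, t)).hasDerivAt_fst_slice.deriv,
      (hQd (y, t)).hasDerivAt_snd_slice.deriv] at h
  have hdir' : ∀ t ∈ Set.Ioo 0 T, Q (0, t) = 0 := by
    intro t ht
    have h : x 0 =ᶠ[nhds t] fun _ => 0 :=
      Filter.eventually_of_mem (Ioo_mem_nhds ht.1 ht.2)
        fun s h => hdir s (Set.Ioo_subset_Icc_self h)
    rw [← hderiv_snd, h.deriv_eq, deriv_const]
  simp only [hderiv_fst, hderiv_snd]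
  set f : ℝ × ℝ → ℝ := fun p => -(2 * lam) * (P p * Q p) with hf
  set g : ℝ × ℝ → ℝ := fun p => Q p ^ 2 + mu * u p ^ 2 + lam * P p ^ 2 with hg
  have hfd : Differentiable ℝ f := by fun_prop
  have hgd : Differentiable ℝ g := by fun_prop
  have hdiv : ∀ y ∈ Set.Icc 0 hs, ∀ t ∈ Set.Icc 0 T,
      fderiv ℝ f (y, t) (1, 0) + fderiv ℝ g (y, t) (0, 1) = 0 := by
    intro y hy t ht
    have hf1 := (hfd (y, t)).hasDerivAt_fst_slice.unique
      (((hPd (y, t)).hasDerivAt_fst_slice.mul (hQd (y, t)).hasDerivAt_fst_slice).const_mul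
        (-(2 * lam)))
    have hg1 := (hgd (y, t)).hasDerivAt_snd_slice.unique
      ((((hQd (y, t)).hasDerivAt_snd_slice.pow 2).add
        (((hud (y, t)).hasDerivAt_snd_slice.pow 2).const_mul mu)).add
        (((hPd (y, t)).hasDerivAt_snd_slice.pow 2).const_mul lam))
    have hcomm : fderiv ℝ P (y, t) (0, 1) = fderiv ℝ Q (y, t) (1, 0) :=
      hx.fderiv_fst_snd_comm (y, t)
    have hQ' : fderiv ℝ u (y, t) (0, 1) = Q (y, t) := rfl
    rw [hf1, hg1, hcomm, hQ']
    norm_num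
    linear_combination (2 * Q (y, t)) * hwave y hy t ht
  have hbalance := integral2_divergence_prod_of_hasFDerivAt f g (fderiv ℝ f) (fderiv ℝ g)
    0 0 hs T hfd.continuous.continuousOn hgd.continuous.continuousOn
    (fun p _ => (hfd p).hasFDerivAt) (fun p _ => (hgd p).hasFDerivAt) (by
      rw [Set.uIcc_of_le hhs.le, Set.uIcc_of_le hT.le]
      refine integrableOn_zero.congr_fun (fun p hp => ?_)
        (measurableSet_Icc.prod measurableSet_Icc)
      exact (hdiv p.1 hp.1 p.2 hp.2).symm)
  have hzero : ∫ y in (0:ℝ)..hs, ∫ t in (0:ℝ)..T,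
      fderiv ℝ f (y, t) (1, 0) + fderiv ℝ g (y, t) (0, 1) = 0 := by
    refine (integral_congr fun y hy => ?_).trans integral_zero
    refine (integral_congr fun t ht => ?_).trans integral_zero
    rw [Set.uIcc_of_le hhs.le] at hy
    rw [Set.uIcc_of_le hT.le] at ht
    exact hdiv y hy t ht
  have hleft : ∫ t in (0:ℝ)..T, f (0, t) = 0 := by
    rw [integral_of_le hT.le, integral_Ioc_eq_integral_Ioo]
    refine setIntegral_eq_zero_of_forall_eq_zero fun t ht => ?_
    simp [hf, hdir' t ht]
  have hright : -∫ t in (0:ℝ)..T, f (hs, t)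
      ≤ lam * ∫ t in (0:ℝ)..T, (P (hs, t) ^ 2 + Q (hs, t) ^ 2) := by
    rw [← intervalIntegral.integral_neg, ← intervalIntegral.integral_const_mul]
    refine integral_mono_on hT.le (Continuous.intervalIntegrable (by fun_prop) _ _)
      (Continuous.intervalIntegrable (by fun_prop) _ _) fun t _ => ?_
    simp only [hf]
    nlinarith [mul_nonneg hlam.le (sq_nonneg (P (hs, t) - Q (hs, t)))]
  have hfinal : ∫ y in (0:ℝ)..hs, (Q (y, T) ^ 2 + lam * P (y, T) ^ 2)
      ≤ ∫ y in (0:ℝ)..hs, g (y, T) := by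
    refine integral_mono_on hhs.le (Continuous.intervalIntegrable (by fun_prop) _ _)
      (Continuous.intervalIntegrable (by fun_prop) _ _) fun y _ => ?_
    simp only [hg]
    nlinarith [mul_nonneg hmu (sq_nonneg (u (y, T)))]
  have hinit : ∫ y in (0:ℝ)..hs, (Q (y, 0) ^ 2 + mu * x y 0 ^ 2 + lam * P (y, 0) ^ 2)
      = ∫ y in (0:ℝ)..hs, g (y, 0) := rfl
  linarith
end

section
/- There exists a constant C > 0, depending only on L, h_s and h, such that for every C² function f on the closure of Ω_0^f that is horizontally periodic, one has sup_{x ∈ Ω_0^f} |f(x) − (1/L²)∫_{(0,L)²} f(x₁,x₂,h_s) dx₁dx₂| ≤ C·((∫_{Ω_0^f} |∇f|² dx)^{1/2} + (∫_{Ω_0^f} |∇²f|² dx)^{1/2}), where ∇²f denotes the matrix of second partial derivatives of f. -/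
/-- Partial derivative of a function of three real variables in the first variable. -/
noncomputable def pd1 (f : ℝ → ℝ → ℝ → ℝ) (x1 x2 x3 : ℝ) : ℝ :=
  deriv (fun s => f s x2 x3) x1

/-- Partial derivative of a function of three real variables in the second variable. -/
noncomputable def pd2 (f : ℝ → ℝ → ℝ → ℝ) (x1 x2 x3 : ℝ) : ℝ :=
  deriv (fun s => f x1 s x3) x2

/-- Partial derivative of a function of three real variables in the third variable. -/
noncomputable def pd3 (f : ℝ → ℝ → ℝ → ℝ) (x1 x2 x3 : ℝ) : ℝ :=
  deriv (fun s => f x1 x2 s) x3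

open MeasureTheory Set

/-- Taylor expansion of `F` about `y`, evaluated at `x`, with integral remainder. -/
lemma ContDiff.eq_taylor_one_integral {E : Type*} [NormedAddCommGroup E] [NormedSpace ℝ E]
    {F : E → ℝ} (hF : ContDiff ℝ 2 F) (x y : E) :
    F x - F y = -fderiv ℝ F y (y - x)
      + ∫ t in (0:ℝ)..1, t * fderiv ℝ (fderiv ℝ F) (x + t • (y - x)) (y - x) (y - x) := by
  have hF1 : ContDiff ℝ 1 (fderiv ℝ F) := hF.fderiv_right (by norm_num)
  have hline : ∀ t : ℝ, HasDerivAt (fun t : ℝ => x + t • (y - x)) (y - x) t := fun t => by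
    simpa using ((hasDerivAt_id t).smul_const (y - x)).const_add x
  have h1 : ∀ t : ℝ, HasDerivAt (fun t : ℝ => F (x + t • (y - x)))
      (fderiv ℝ F (x + t • (y - x)) (y - x)) t := fun t =>
    ((hF.differentiable (by norm_num)) _).hasFDerivAt.comp_hasDerivAt t (hline t)
  have h2 : ∀ t : ℝ, HasDerivAt (fun t : ℝ => fderiv ℝ F (x + t • (y - x)) (y - x))
      (fderiv ℝ (fderiv ℝ F) (x + t • (y - x)) (y - x) (y - x)) t := fun t => by
    have := ((hF1.differentiable (by norm_num)) _).hasFDerivAt.comp_hasDerivAt t (hline t)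
    simpa using this.clm_apply (hasDerivAt_const t (y - x))
  have h3 : ∀ t : ℝ, HasDerivAt
      (fun t : ℝ => t * fderiv ℝ F (x + t • (y - x)) (y - x) - F (x + t • (y - x)))
      (t * fderiv ℝ (fderiv ℝ F) (x + t • (y - x)) (y - x) (y - x)) t := fun t => by
    refine (((hasDerivAt_id' t).mul (h2 t)).sub (h1 t)).congr_deriv ?_
    ring
  have hc : Continuous (fderiv ℝ (fderiv ℝ F)) := hF1.continuous_fderiv (by norm_num)
  rw [intervalIntegral.integral_eq_sub_of_hasDerivAt (fun t _ => h3 t)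
    (Continuous.intervalIntegrable (by fun_prop) _ _)]
  simp
  ring

lemma ContDiff.continuous_norm_fderiv {E : Type*} [NormedAddCommGroup E] [NormedSpace ℝ E]
    {F : E → ℝ} (hF : ContDiff ℝ 2 F) : Continuous fun z => ‖fderiv ℝ F z‖ :=
  continuous_norm.comp (hF.continuous_fderiv (by norm_num))

lemma ContDiff.continuous_norm_fderiv_fderiv {E : Type*} [NormedAddCommGroup E] [NormedSpace ℝ E]
    {F : E → ℝ} (hF : ContDiff ℝ 2 F) : Continuous fun z => ‖fderiv ℝ (fderiv ℝ F) z‖ :=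
  continuous_norm.comp
    ((hF.fderiv_right (m := 1) (by norm_num)).continuous_fderiv (by norm_num))

lemma ContDiff.abs_sub_le_integral_norm_fderiv_fderiv {E : Type*} [NormedAddCommGroup E]
    [NormedSpace ℝ E] {F : E → ℝ} (hF : ContDiff ℝ 2 F) {x y : E} {R : ℝ} (hR : ‖y - x‖ ≤ R) :
    |F x - F y| ≤ R * ‖fderiv ℝ F y‖
      + R ^ 2 * ∫ t in (0:ℝ)..1, t * ‖fderiv ℝ (fderiv ℝ F) (x + t • (y - x))‖ := by
  rw [hF.eq_taylor_one_integral x y]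
  refine (abs_add_le _ _).trans (add_le_add ?_ ?_)
  · rw [abs_neg, mul_comm]
    exact ((fderiv ℝ F y).le_opNorm (y - x)).trans (by gcongr)
  · rw [← intervalIntegral.integral_const_mul]
    have hcont : Continuous fun t : ℝ => ‖fderiv ℝ (fderiv ℝ F) (x + t • (y - x))‖ :=
      hF.continuous_norm_fderiv_fderiv.comp (by fun_prop : Continuous fun t : ℝ => x + t • (y - x))
    rw [← Real.norm_eq_abs]
    have hi : IntervalIntegrable
        (fun t => R ^ 2 * (t * ‖fderiv ℝ (fderiv ℝ F) (x + t • (y - x))‖)) volume 0 1 :=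
      Continuous.intervalIntegrable (by fun_prop) _ _
    refine intervalIntegral.norm_integral_le_of_norm_le zero_le_one ?_ hi
    refine Filter.Eventually.of_forall fun t ht => ?_
    rw [norm_mul, Real.norm_of_nonneg ht.1.le]
    calc _ ≤ t * (‖fderiv ℝ (fderiv ℝ F) (x + t • (y - x))‖ * R * R) := by
          have := ht.1.le
          gcongr
          refine ((fderiv ℝ (fderiv ℝ F) (x + t • (y - x))).le_opNorm₂ (y - x) (y - x)).trans ?_
          have : 0 ≤ R := (norm_nonneg _).trans hR
          gcongr
      _ = _ := by ring

/-- Cauchy–Schwarz against the constant function on a set of finite measure. -/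
lemma MeasureTheory.integral_le_sqrt_mul_sqrt {α : Type*} [MeasurableSpace α] {μ : Measure α}
    [IsFiniteMeasure μ] {g : α → ℝ} (hg : Integrable g μ) (hg2 : Integrable (fun a => g a ^ 2) μ) :
    ∫ a, g a ∂μ ≤ √(μ.real univ) * √(∫ a, g a ^ 2 ∂μ) := by
  rw [← Real.sqrt_mul measureReal_nonneg]
  apply Real.le_sqrt_of_sq_le
  rcases eq_or_lt_of_le (measureReal_nonneg : 0 ≤ μ.real univ) with h0 | hpos
  · have : μ = 0 := by
      rw [← Measure.measure_univ_eq_zero]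
      exact (measureReal_eq_zero_iff).1 h0.symm
    simp [this]
  · set m := ∫ a, g a ∂μ
    set V := μ.real univ
    have h : 0 ≤ ∫ a, (V * g a - m) ^ 2 ∂μ := integral_nonneg fun a => sq_nonneg _
    have he : ∫ a, (V * g a - m) ^ 2 ∂μ = V ^ 2 * ∫ a, g a ^ 2 ∂μ - 2 * V * m * m + V * m ^ 2 := by
      have : ∀ a, (V * g a - m) ^ 2 = V ^ 2 * g a ^ 2 - 2 * V * m * g a + m ^ 2 := fun a => by ring
      simp_rw [this]
      rw [integral_add (by fun_prop) (by fun_prop), integral_sub (by fun_prop) (by fun_prop),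
        integral_const_mul, integral_const_mul, integral_const]
      rfl
    rw [he] at h
    refine le_of_mul_le_mul_left ?_ hpos
    nlinarith

/-- Contracting a convex set towards one of its points expands integrals at most by the Jacobian. -/
lemma Convex.setIntegral_comp_homothety_le {E : Type*} [NormedAddCommGroup E] [NormedSpace ℝ E]
    [FiniteDimensional ℝ E] [MeasurableSpace E] [BorelSpace E] (μ : Measure E)
    [μ.IsAddHaarMeasure] {B : Set E} (hB : IsCompact B) (hconv : Convex ℝ B) {x : E} (hx : x ∈ B)
    {u : E → ℝ} (hu : Continuous u) (hu0 : ∀ z, 0 ≤ u z) {t : ℝ} (ht : t ∈ Ioc (0:ℝ) 1) :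
    ∫ y in B, u (x + t • (y - x)) ∂μ ≤ (t ^ Module.finrank ℝ E)⁻¹ * ∫ y in B, u y ∂μ := by
  have hBm := hB.measurableSet
  have hi : Integrable (B.indicator u) μ :=
    (integrable_indicator_iff hBm).2 (hu.continuousOn.integrableOn_compact hB)
  have hi' : Integrable (fun y => B.indicator u ((x - t • x) + t • y)) μ :=
    (hi.comp_add_left (x - t • x)).comp_smul ht.1.ne'
  have key : ∫ y, B.indicator u ((x - t • x) + t • y) ∂μ
      = (t ^ Module.finrank ℝ E)⁻¹ * ∫ y in B, u y ∂μ := by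
    rw [Measure.integral_comp_smul μ (fun z => B.indicator u ((x - t • x) + z)) t,
      integral_add_left_eq_self, integral_indicator hBm, smul_eq_mul,
      abs_of_pos (inv_pos.2 (pow_pos ht.1 _))]
  rw [← key, ← integral_indicator hBm]
  refine integral_mono ((integrable_indicator_iff hBm).2
    (Continuous.continuousOn (by fun_prop) |>.integrableOn_compact hB)) hi' fun y => ?_
  by_cases hy : y ∈ B
  · have e : (x - t • x) + t • y = x + t • (y - x) := by rw [smul_sub]; abel
    have hm : x + t • (y - x) ∈ B := hconv.add_smul_sub_mem hx hy ⟨ht.1.le, ht.2⟩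
    simp [hy, e, hm]
  · simp only [hy, not_false_eq_true, indicator_of_notMem]
    exact indicator_nonneg (fun z _ => hu0 z) _

/-- A pointwise first-order Taylor estimate in dimension three controls the difference between
a point value and the mean over a convex body. -/
lemma abs_measureReal_mul_sub_setIntegral_le_of_pointwise {E : Type*} [NormedAddCommGroup E]
    [NormedSpace ℝ E] [FiniteDimensional ℝ E] [MeasurableSpace E] [BorelSpace E] (μ : Measure E)
    [μ.IsAddHaarMeasure] (hE : Module.finrank ℝ E = 3) {B : Set E} (hB : IsCompact B)
    (hconv : Convex ℝ B) {x : E} (hx : x ∈ B) {R : ℝ} {F a b : E → ℝ} (hcF : Continuous F)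
    (ha : Continuous a) (hb : Continuous b)
    (hpt : ∀ y ∈ B, |F x - F y| ≤ R * a y + R ^ 2 * ∫ t in (0:ℝ)..1, t * b (x + t • (y - x))) :
    |μ.real B * F x - ∫ y in B, F y ∂μ| ≤ R * ∫ y in B, a y ∂μ
      + 2 * R ^ 2 * √(μ.real B) * √(∫ y in B, b y ^ 2 ∂μ) := by
  have hint : ∀ {g : E → ℝ}, Continuous g → IntegrableOn g B μ := fun hg =>
    hg.continuousOn.integrableOn_compact hB
  have hBfin : μ B < ⊤ := hB.measure_lt_top
  have : IsFiniteMeasure (μ.restrict B) := ⟨by simpa using hBfin⟩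
  set S := √(μ.real B) * √(∫ y in B, b y ^ 2 ∂μ) with hS
  have hslice : ∀ t ∈ Ioc (0:ℝ) 1,
      ∫ y in B, t * b (x + t • (y - x)) ∂μ ≤ t ^ (-(1/2):ℝ) * S := by
    intro t ht
    have ht0 := ht.1
    rw [integral_const_mul]
    have h1 := integral_le_sqrt_mul_sqrt (μ := μ.restrict B)
      (g := fun y => b (x + t • (y - x)))
      (hint (by fun_prop)) (hint (by fun_prop))
    have h2 := hconv.setIntegral_comp_homothety_le μ hB hx
      (u := fun y => b y ^ 2) (by fun_prop) (fun _ => sq_nonneg _) ht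
    rw [measureReal_restrict_apply_univ] at h1
    calc _ ≤ t * (√(μ.real B) * √((t ^ Module.finrank ℝ E)⁻¹
              * ∫ y in B, b y ^ 2 ∂μ)) := by
          gcongr
          exact h1.trans (by gcongr)
      _ = t ^ (-(1/2):ℝ) * S := by
          have e : t * √((t ^ 3)⁻¹) = t ^ (-(1/2):ℝ) := by
            rw [Real.sqrt_eq_rpow, ← Real.rpow_natCast, ← Real.rpow_neg ht0.le,
              ← Real.rpow_mul ht0.le]
            nth_rewrite 1 [← Real.rpow_one t]
            rw [← Real.rpow_add ht0]
            norm_num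
          rw [hE, Real.sqrt_mul (by positivity), ← e, hS]
          ring
  have hcont2 : Continuous fun p : E × ℝ => p.2 * b (x + p.2 • (p.1 - x)) := by
    fun_prop
  have hinner : Continuous fun y => ∫ t in (0:ℝ)..1,
      t * b (x + t • (y - x)) :=
    intervalIntegral.continuous_parametric_intervalIntegral_of_continuous' hcont2 0 1
  have hswap : ∫ y in B, (∫ t in (0:ℝ)..1, t * b (x + t • (y - x))) ∂μ
      = ∫ t in (0:ℝ)..1, ∫ y in B, t * b (x + t • (y - x)) ∂μ := by
    simp_rw [intervalIntegral.integral_of_le (zero_le_one' ℝ)]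
    refine integral_integral_swap ?_
    rw [Measure.prod_restrict]
    exact (hcont2.continuousOn.integrableOn_compact (hB.prod isCompact_Icc)).mono_set
      (prod_mono_right Ioc_subset_Icc_self)
  have hrem : ∫ t in (0:ℝ)..1, ∫ y in B, t * b (x + t • (y - x)) ∂μ
      ≤ 2 * S := by
    have hpow : IntervalIntegrable (fun t : ℝ => t ^ (-(1/2):ℝ) * S) volume 0 1 :=
      (intervalIntegral.intervalIntegrable_rpow' (by norm_num)).mul_const S
    have hval : ∫ t in (0:ℝ)..1, t ^ (-(1/2):ℝ) * S = 2 * S := by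
      rw [intervalIntegral.integral_mul_const, integral_rpow (Or.inl (by norm_num))]
      norm_num
    rw [← hval]
    refine intervalIntegral.integral_mono_on_of_le_Ioo zero_le_one ?_ hpow
      fun t ht => hslice t ⟨ht.1, ht.2.le⟩
    apply Continuous.intervalIntegrable
    exact continuous_parametric_integral_of_continuous
      (f := fun t y => t * b (x + t • (y - x))) (by fun_prop) hB
  have hconst : μ.real B * F x - ∫ y in B, F y ∂μ = ∫ y in B, (F x - F y) ∂μ := by
    rw [integral_sub (by fun_prop) (hint hcF), integral_const]
    simp
  rw [hconst]
  calc |∫ y in B, (F x - F y) ∂μ| ≤ ∫ y in B, (R * a y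
      + R ^ 2 * ∫ t in (0:ℝ)..1, t * b (x + t • (y - x))) ∂μ := by
        have hi : IntegrableOn (fun y => R * a y
            + R ^ 2 * ∫ t in (0:ℝ)..1, t * b (x + t • (y - x))) B μ := hint (by fun_prop)
        rw [← Real.norm_eq_abs]
        refine norm_integral_le_of_norm_le hi ?_
        exact (ae_restrict_iff' hB.measurableSet).2 (Filter.Eventually.of_forall hpt)
    _ = R * ∫ y in B, a y ∂μ + R ^ 2 * ∫ y in B, (∫ t in (0:ℝ)..1,
          t * b (x + t • (y - x))) ∂μ := by
        rw [integral_add (hint (by fun_prop)) (hint (by fun_prop)), integral_const_mul,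
          integral_const_mul]
    _ ≤ R * ∫ y in B, a y ∂μ + R ^ 2 * (2 * S) := by
        rw [hswap]
        gcongr
    _ = _ := by rw [hS]; ring

/-- The difference between a point value and the mean over a convex body in dimension three. -/
lemma ContDiff.abs_measureReal_mul_sub_setIntegral_le {E : Type*} [NormedAddCommGroup E]
    [NormedSpace ℝ E] [FiniteDimensional ℝ E] [MeasurableSpace E] [BorelSpace E] (μ : Measure E)
    [μ.IsAddHaarMeasure] (hE : Module.finrank ℝ E = 3) {B : Set E} (hB : IsCompact B)
    (hconv : Convex ℝ B) {x : E} (hx : x ∈ B) {R : ℝ} (hR : ∀ y ∈ B, ‖y - x‖ ≤ R)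
    {F : E → ℝ} (hF : ContDiff ℝ 2 F) :
    |μ.real B * F x - ∫ y in B, F y ∂μ| ≤ R * ∫ y in B, ‖fderiv ℝ F y‖ ∂μ
      + 2 * R ^ 2 * √(μ.real B) * √(∫ y in B, ‖fderiv ℝ (fderiv ℝ F) y‖ ^ 2 ∂μ) :=
  abs_measureReal_mul_sub_setIntegral_le_of_pointwise μ hE hB hconv hx hF.continuous
    hF.continuous_norm_fderiv hF.continuous_norm_fderiv_fderiv fun y hy =>
      hF.abs_sub_le_integral_norm_fderiv_fderiv (hR y hy)

lemma ContinuousLinearMap.norm_sq_le_of_prod {G : Type*} [NormedAddCommGroup G] [NormedSpace ℝ G]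
    (A : ℝ × ℝ × ℝ →L[ℝ] G) :
    ‖A‖ ^ 2 ≤ 3 * (‖A (1, 0, 0)‖ ^ 2 + ‖A (0, 1, 0)‖ ^ 2 + ‖A (0, 0, 1)‖ ^ 2) := by
  have h : ‖A‖ ≤ ‖A (1, 0, 0)‖ + ‖A (0, 1, 0)‖ + ‖A (0, 0, 1)‖ := by
    refine A.opNorm_le_bound (by positivity) fun v => ?_
    have hv : v = v.1 • ((1, 0, 0) : ℝ × ℝ × ℝ) + v.2.1 • ((0, 1, 0) : ℝ × ℝ × ℝ)
        + v.2.2 • ((0, 0, 1) : ℝ × ℝ × ℝ) := by ext <;> simp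
    have h1 : ‖v.1‖ ≤ ‖v‖ := le_max_left _ _
    have h2 : ‖v.2.1‖ ≤ ‖v‖ := (le_max_left _ _).trans (le_max_right _ _)
    have h3 : ‖v.2.2‖ ≤ ‖v‖ := (le_max_right _ _).trans (le_max_right _ _)
    calc ‖A v‖ = ‖v.1 • A (1, 0, 0) + v.2.1 • A (0, 1, 0) + v.2.2 • A (0, 0, 1)‖ := by
          conv_lhs => rw [hv]
          simp only [map_add, map_smul]
      _ ≤ ‖v.1‖ * ‖A (1, 0, 0)‖ + ‖v.2.1‖ * ‖A (0, 1, 0)‖ + ‖v.2.2‖ * ‖A (0, 0, 1)‖ := by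
          simpa only [norm_smul] using norm_add₃_le (a := v.1 • A (1, 0, 0))
            (b := v.2.1 • A (0, 1, 0)) (c := v.2.2 • A (0, 0, 1))
      _ ≤ ‖v‖ * ‖A (1, 0, 0)‖ + ‖v‖ * ‖A (0, 1, 0)‖ + ‖v‖ * ‖A (0, 0, 1)‖ := by gcongr
      _ = _ := by ring
  set a := ‖A (1, 0, 0)‖
  set b := ‖A (0, 1, 0)‖
  set c := ‖A (0, 0, 1)‖
  calc ‖A‖ ^ 2 ≤ (a + b + c) ^ 2 := by gcongr
    _ ≤ _ := by nlinarith [sq_nonneg (a - b), sq_nonneg (b - c), sq_nonneg (a - c)]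

lemma pd1_eq_fderiv {F : ℝ × ℝ × ℝ → ℝ} (hF : Differentiable ℝ F) :
    pd1 (fun a b c => F (a, b, c)) = fun a b c => fderiv ℝ F (a, b, c) (1, 0, 0) := by
  ext a b c
  exact ((hF _).hasFDerivAt.comp_hasDerivAt a ((hasDerivAt_id a).prodMk
    ((hasDerivAt_const a b).prodMk (hasDerivAt_const a c)))).deriv

lemma pd2_eq_fderiv {F : ℝ × ℝ × ℝ → ℝ} (hF : Differentiable ℝ F) :
    pd2 (fun a b c => F (a, b, c)) = fun a b c => fderiv ℝ F (a, b, c) (0, 1, 0) := by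
  ext a b c
  exact ((hF _).hasFDerivAt.comp_hasDerivAt b ((hasDerivAt_const b a).prodMk
    ((hasDerivAt_id b).prodMk (hasDerivAt_const b c)))).deriv

lemma hasDerivAt_third {F : ℝ × ℝ × ℝ → ℝ} (hF : Differentiable ℝ F) (a b c : ℝ) :
    HasDerivAt (fun s => F (a, b, s)) (fderiv ℝ F (a, b, c) (0, 0, 1)) c :=
  (hF _).hasFDerivAt.comp_hasDerivAt c ((hasDerivAt_const c a).prodMk
    ((hasDerivAt_const c b).prodMk (hasDerivAt_id c)))

lemma pd3_eq_fderiv {F : ℝ × ℝ × ℝ → ℝ} (hF : Differentiable ℝ F) :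
    pd3 (fun a b c => F (a, b, c)) = fun a b c => fderiv ℝ F (a, b, c) (0, 0, 1) := by
  ext a b c
  exact (hasDerivAt_third hF a b c).deriv

lemma fderiv_fderiv_apply_const {F : ℝ × ℝ × ℝ → ℝ} (hF : ContDiff ℝ 2 F) (p v w : ℝ × ℝ × ℝ) :
    fderiv ℝ (fun q => fderiv ℝ F q v) p w = fderiv ℝ (fderiv ℝ F) p w v := by
  have hF1 : ContDiff ℝ 1 (fderiv ℝ F) := hF.fderiv_right (by norm_num)
  rw [fderiv_clm_apply (hF1.differentiable (by norm_num) p) (differentiableAt_const v)]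
  simp

/-- Integration over a closed box as an iterated integral. -/
lemma setIntegral_box_eq {a₁ b₁ a₂ b₂ a₃ b₃ : ℝ} (h₁ : a₁ ≤ b₁) (h₂ : a₂ ≤ b₂) (h₃ : a₃ ≤ b₃)
    {g : ℝ × ℝ × ℝ → ℝ} (hg : Continuous g) :
    ∫ p in Icc a₁ b₁ ×ˢ (Icc a₂ b₂ ×ˢ Icc a₃ b₃), g p
      = ∫ y₁ in a₁..b₁, ∫ y₂ in a₂..b₂, ∫ y₃ in a₃..b₃, g (y₁, y₂, y₃) := by
  rw [Measure.volume_eq_prod, setIntegral_prod _ (hg.continuousOn.integrableOn_compact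
    (isCompact_Icc.prod (isCompact_Icc.prod isCompact_Icc))), integral_Icc_eq_integral_Ioc,
    intervalIntegral.integral_of_le h₁]
  congr 1 with y₁
  have hg₁ : Continuous fun q : ℝ × ℝ => g (y₁, q) := by fun_prop
  rw [Measure.volume_eq_prod, setIntegral_prod _ (hg₁.continuousOn.integrableOn_compact
    (isCompact_Icc.prod isCompact_Icc)), integral_Icc_eq_integral_Ioc,
    intervalIntegral.integral_of_le h₂]
  congr 1 with y₂
  rw [integral_Icc_eq_integral_Ioc, intervalIntegral.integral_of_le h₃]

lemma setIntegral_box_norm_fderiv_sq_le {a₁ b₁ a₂ b₂ a₃ b₃ : ℝ} (h₁ : a₁ ≤ b₁) (h₂ : a₂ ≤ b₂)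
    (h₃ : a₃ ≤ b₃) {F : ℝ × ℝ × ℝ → ℝ} (hF : ContDiff ℝ 2 F) :
    ∫ p in Icc a₁ b₁ ×ˢ (Icc a₂ b₂ ×ˢ Icc a₃ b₃), ‖fderiv ℝ F p‖ ^ 2
      ≤ 3 * ∫ y₁ in a₁..b₁, ∫ y₂ in a₂..b₂, ∫ y₃ in a₃..b₃,
          ((pd1 (fun a b c => F (a, b, c)) y₁ y₂ y₃) ^ 2
            + (pd2 (fun a b c => F (a, b, c)) y₁ y₂ y₃) ^ 2
            + (pd3 (fun a b c => F (a, b, c)) y₁ y₂ y₃) ^ 2) := by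
  have hF0 : Differentiable ℝ F := hF.differentiable (by norm_num)
  have hcv : ∀ v, Continuous fun p => fderiv ℝ F p v := fun v =>
    (hF.continuous_fderiv (by norm_num)).clm_apply continuous_const
  have hc : Continuous fun p => fderiv ℝ F p (1, 0, 0) ^ 2 + fderiv ℝ F p (0, 1, 0) ^ 2
      + fderiv ℝ F p (0, 0, 1) ^ 2 :=
    (((hcv _).pow 2).add ((hcv _).pow 2)).add ((hcv _).pow 2)
  have hB := (isCompact_Icc (a := a₁) (b := b₁)).prod
    ((isCompact_Icc (a := a₂) (b := b₂)).prod (isCompact_Icc (a := a₃) (b := b₃)))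
  simp only [pd1_eq_fderiv hF0, pd2_eq_fderiv hF0, pd3_eq_fderiv hF0]
  rw [← setIntegral_box_eq h₁ h₂ h₃ hc, ← integral_const_mul]
  refine integral_mono ((hF.continuous_norm_fderiv.pow 2).continuousOn.integrableOn_compact hB)
    ((hc.const_mul 3).continuousOn.integrableOn_compact hB) fun p => ?_
  simpa only [Real.norm_eq_abs, sq_abs] using (fderiv ℝ F p).norm_sq_le_of_prod

lemma setIntegral_box_norm_fderiv_fderiv_sq_le {a₁ b₁ a₂ b₂ a₃ b₃ : ℝ} (h₁ : a₁ ≤ b₁)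
    (h₂ : a₂ ≤ b₂) (h₃ : a₃ ≤ b₃) {F : ℝ × ℝ × ℝ → ℝ} (hF : ContDiff ℝ 2 F) :
    ∫ p in Icc a₁ b₁ ×ˢ (Icc a₂ b₂ ×ˢ Icc a₃ b₃), ‖fderiv ℝ (fderiv ℝ F) p‖ ^ 2
      ≤ 9 * ∫ y₁ in a₁..b₁, ∫ y₂ in a₂..b₂, ∫ y₃ in a₃..b₃,
          ((pd1 (pd1 fun a b c => F (a, b, c)) y₁ y₂ y₃) ^ 2
            + (pd1 (pd2 fun a b c => F (a, b, c)) y₁ y₂ y₃) ^ 2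
            + (pd1 (pd3 fun a b c => F (a, b, c)) y₁ y₂ y₃) ^ 2
            + (pd2 (pd1 fun a b c => F (a, b, c)) y₁ y₂ y₃) ^ 2
            + (pd2 (pd2 fun a b c => F (a, b, c)) y₁ y₂ y₃) ^ 2
            + (pd2 (pd3 fun a b c => F (a, b, c)) y₁ y₂ y₃) ^ 2
            + (pd3 (pd1 fun a b c => F (a, b, c)) y₁ y₂ y₃) ^ 2
            + (pd3 (pd2 fun a b c => F (a, b, c)) y₁ y₂ y₃) ^ 2
            + (pd3 (pd3 fun a b c => F (a, b, c)) y₁ y₂ y₃) ^ 2) := by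
  have hF0 : Differentiable ℝ F := hF.differentiable (by norm_num)
  have hF1 : ContDiff ℝ 1 (fderiv ℝ F) := hF.fderiv_right (by norm_num)
  have hdv : ∀ v, Differentiable ℝ fun p => fderiv ℝ F p v := fun v =>
    (hF1.differentiable (by norm_num)).clm_apply (differentiable_const v)
  have hcv : ∀ v w, Continuous fun p => fderiv ℝ (fderiv ℝ F) p w v ^ 2 := fun v w =>
    (((hF1.continuous_fderiv (by norm_num)).clm_apply continuous_const).clm_apply
      continuous_const).pow 2
  have hB := (isCompact_Icc (a := a₁) (b := b₁)).prod
    ((isCompact_Icc (a := a₂) (b := b₂)).prod (isCompact_Icc (a := a₃) (b := b₃)))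
  simp only [pd1_eq_fderiv hF0, pd2_eq_fderiv hF0, pd3_eq_fderiv hF0, pd1_eq_fderiv (hdv _),
    pd2_eq_fderiv (hdv _), pd3_eq_fderiv (hdv _), fderiv_fderiv_apply_const hF]
  have hc : Continuous fun p => fderiv ℝ (fderiv ℝ F) p (1, 0, 0) (1, 0, 0) ^ 2
      + fderiv ℝ (fderiv ℝ F) p (1, 0, 0) (0, 1, 0) ^ 2
      + fderiv ℝ (fderiv ℝ F) p (1, 0, 0) (0, 0, 1) ^ 2
      + fderiv ℝ (fderiv ℝ F) p (0, 1, 0) (1, 0, 0) ^ 2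
      + fderiv ℝ (fderiv ℝ F) p (0, 1, 0) (0, 1, 0) ^ 2
      + fderiv ℝ (fderiv ℝ F) p (0, 1, 0) (0, 0, 1) ^ 2
      + fderiv ℝ (fderiv ℝ F) p (0, 0, 1) (1, 0, 0) ^ 2
      + fderiv ℝ (fderiv ℝ F) p (0, 0, 1) (0, 1, 0) ^ 2
      + fderiv ℝ (fderiv ℝ F) p (0, 0, 1) (0, 0, 1) ^ 2 := by
    refine .add (.add (.add (.add (.add (.add (.add (.add ?_ ?_) ?_) ?_) ?_) ?_) ?_) ?_) ?_ <;>
    exact hcv _ _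
  rw [← setIntegral_box_eq h₁ h₂ h₃ hc, ← integral_const_mul]
  refine integral_mono
    ((hF.continuous_norm_fderiv_fderiv.pow 2).continuousOn.integrableOn_compact hB)
    ((hc.const_mul 9).continuousOn.integrableOn_compact hB) fun p => ?_
  have h0 := (fderiv ℝ (fderiv ℝ F) p).norm_sq_le_of_prod
  have hrow := fun v => (fderiv ℝ (fderiv ℝ F) p v).norm_sq_le_of_prod
  simp only [Real.norm_eq_abs, sq_abs] at hrow
  dsimp only
  linarith [hrow (1, 0, 0), hrow (0, 1, 0), hrow (0, 0, 1)]

/-- Comparison of the integral over a box with the integral over its bottom face. -/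
lemma abs_setIntegral_box_sub_le {a₁ b₁ a₂ b₂ a₃ b₃ : ℝ} (h₁ : a₁ ≤ b₁) (h₂ : a₂ ≤ b₂)
    (h₃ : a₃ ≤ b₃) {F : ℝ × ℝ × ℝ → ℝ} (hF : ContDiff ℝ 2 F) :
    |(∫ p in Icc a₁ b₁ ×ˢ (Icc a₂ b₂ ×ˢ Icc a₃ b₃), F p)
        - (b₃ - a₃) * ∫ y₁ in a₁..b₁, ∫ y₂ in a₂..b₂, F (y₁, y₂, a₃)|
      ≤ (b₃ - a₃) * ∫ p in Icc a₁ b₁ ×ˢ (Icc a₂ b₂ ×ˢ Icc a₃ b₃), ‖fderiv ℝ F p‖ := by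
  have hB := (isCompact_Icc (a := a₁) (b := b₁)).prod
    ((isCompact_Icc (a := a₂) (b := b₂)).prod (isCompact_Icc (a := a₃) (b := b₃)))
  have hcF := hF.continuous
  have hcN := hF.continuous_norm_fderiv
  have hc3 : Continuous fun p => fderiv ℝ F p (0, 0, 1) :=
    (hF.continuous_fderiv (by norm_num)).clm_apply continuous_const
  have hface : Continuous fun p : ℝ × ℝ × ℝ => F (p.1, p.2.1, a₃) := by fun_prop
  have hcol : Continuous fun p : ℝ × ℝ × ℝ => ∫ s in a₃..b₃, ‖fderiv ℝ F (p.1, p.2.1, s)‖ := by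
    refine intervalIntegral.continuous_parametric_intervalIntegral_of_continuous' ?_ a₃ b₃
    exact hcN.comp (by fun_prop : Continuous fun q : (ℝ × ℝ × ℝ) × ℝ => (q.1.1, q.1.2.1, q.2))
  have e1 : (b₃ - a₃) * ∫ y₁ in a₁..b₁, ∫ y₂ in a₂..b₂, F (y₁, y₂, a₃)
      = ∫ p in Icc a₁ b₁ ×ˢ (Icc a₂ b₂ ×ˢ Icc a₃ b₃), F (p.1, p.2.1, a₃) := by
    rw [setIntegral_box_eq h₁ h₂ h₃ hface]
    simp
  have e2 : (b₃ - a₃) * ∫ p in Icc a₁ b₁ ×ˢ (Icc a₂ b₂ ×ˢ Icc a₃ b₃), ‖fderiv ℝ F p‖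
      = ∫ p in Icc a₁ b₁ ×ˢ (Icc a₂ b₂ ×ˢ Icc a₃ b₃),
          ∫ s in a₃..b₃, ‖fderiv ℝ F (p.1, p.2.1, s)‖ := by
    rw [setIntegral_box_eq h₁ h₂ h₃ hcol, setIntegral_box_eq h₁ h₂ h₃ hcN]
    simp
  rw [e1, e2, ← integral_sub (hcF.continuousOn.integrableOn_compact hB)
    (hface.continuousOn.integrableOn_compact hB)]
  rw [← Real.norm_eq_abs]
  refine norm_integral_le_of_norm_le (hcol.continuousOn.integrableOn_compact hB) ?_
  refine (ae_restrict_iff' hB.measurableSet).2 (Filter.Eventually.of_forall ?_)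
  rintro ⟨y₁, y₂, y₃⟩ ⟨-, -, hy⟩
  have hline : Continuous fun s : ℝ => (y₁, y₂, s) := by fun_prop
  have hN : Continuous fun s : ℝ => ‖fderiv ℝ F (y₁, y₂, s)‖ := hcN.comp hline
  dsimp only
  rw [← intervalIntegral.integral_eq_sub_of_hasDerivAt
    (fun s _ => hasDerivAt_third (hF.differentiable (by norm_num)) y₁ y₂ s)
    ((hc3.comp hline).intervalIntegrable _ _)]
  calc _ ≤ ∫ s in a₃..y₃, ‖fderiv ℝ F (y₁, y₂, s)‖ := by
        refine intervalIntegral.norm_integral_le_of_norm_le hy.1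
          (Filter.Eventually.of_forall fun s _ => ?_) (hN.intervalIntegrable _ _)
        have := (fderiv ℝ F (y₁, y₂, s)).le_opNorm (0, 0, 1)
        simpa [Prod.norm_mk] using this
    _ ≤ _ := intervalIntegral.integral_mono_interval le_rfl hy.1 hy.2
        (Filter.Eventually.of_forall fun _ => norm_nonneg _) (hN.intervalIntegrable _ _)

/-- L∞ Poincaré–Wirtinger-type inequality on the fluid box
`Ω_0^f = (0,L)² × (h_s,h)`, where the average is taken over the bottom face
`Γ = (0,L)² × {h_s}`. -/
theorem stmt_4 (L hs h : ℝ) (hL : 0 < L) (hhs : 0 < hs) (hsh : hs < h) :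
    ∃ C : ℝ, 0 < C ∧ ∀ f : ℝ → ℝ → ℝ → ℝ,
      ContDiff ℝ 2 (fun p : ℝ × ℝ × ℝ => f p.1 p.2.1 p.2.2) →
      (∀ x1 x2 x3 : ℝ, f (x1 + L) x2 x3 = f x1 x2 x3 ∧ f x1 (x2 + L) x3 = f x1 x2 x3) →
      ∀ x1 ∈ Set.Ioo (0:ℝ) L, ∀ x2 ∈ Set.Ioo (0:ℝ) L, ∀ x3 ∈ Set.Ioo hs h,
        |f x1 x2 x3 - (1 / L ^ 2) * ∫ y1 in (0:ℝ)..L, ∫ y2 in (0:ℝ)..L, f y1 y2 hs|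
          ≤ C * (Real.sqrt (∫ y1 in (0:ℝ)..L, ∫ y2 in (0:ℝ)..L, ∫ y3 in hs..h,
                  ((pd1 f y1 y2 y3) ^ 2 + (pd2 f y1 y2 y3) ^ 2 + (pd3 f y1 y2 y3) ^ 2))
              + Real.sqrt (∫ y1 in (0:ℝ)..L, ∫ y2 in (0:ℝ)..L, ∫ y3 in hs..h,
                  ((pd1 (pd1 f) y1 y2 y3) ^ 2 + (pd1 (pd2 f) y1 y2 y3) ^ 2
                    + (pd1 (pd3 f) y1 y2 y3) ^ 2
                    + (pd2 (pd1 f) y1 y2 y3) ^ 2 + (pd2 (pd2 f) y1 y2 y3) ^ 2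
                    + (pd2 (pd3 f) y1 y2 y3) ^ 2
                    + (pd3 (pd1 f) y1 y2 y3) ^ 2 + (pd3 (pd2 f) y1 y2 y3) ^ 2
                    + (pd3 (pd3 f) y1 y2 y3) ^ 2))) := by
  have hd : 0 < h - hs := sub_pos.2 hsh
  have hV : 0 < L ^ 2 * (h - hs) := by positivity
  set R := L + (h - hs) with hRdef
  have hR0 : 0 < R := by positivity
  refine ⟨(4 * R + 6 * R ^ 2) / √(L ^ 2 * (h - hs)), by positivity, ?_⟩
  intro f hf _ x1 hx1 x2 hx2 x3 hx3
  obtain ⟨F, rfl⟩ : ∃ F : ℝ × ℝ × ℝ → ℝ, f = fun a b c => F (a, b, c) :=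
    ⟨fun p => f p.1 p.2.1 p.2.2, rfl⟩
  replace hf : ContDiff ℝ 2 F := hf
  have hgrad := setIntegral_box_norm_fderiv_sq_le hL.le hL.le hsh.le hf
  have hhess := setIntegral_box_norm_fderiv_fderiv_sq_le hL.le hL.le hsh.le hf
  have htrace := abs_setIntegral_box_sub_le hL.le hL.le hsh.le hf
  set B : Set (ℝ × ℝ × ℝ) := Icc 0 L ×ˢ (Icc 0 L ×ˢ Icc hs h) with hBdef
  have hB : IsCompact B := isCompact_Icc.prod (isCompact_Icc.prod isCompact_Icc)
  have : IsFiniteMeasure ((volume : Measure (ℝ × ℝ × ℝ)).restrict B) :=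
    ⟨by simpa using hB.measure_lt_top⟩
  have hBvol : volume.real B = L ^ 2 * (h - hs) := by
    have := setIntegral_box_eq hL.le hL.le hsh.le (continuous_const (y := (1:ℝ)))
    rw [setIntegral_const, smul_eq_mul, mul_one] at this
    rw [this]
    simp
    ring
  have hxB : (x1, x2, x3) ∈ B :=
    ⟨Ioo_subset_Icc_self hx1, Ioo_subset_Icc_self hx2, Ioo_subset_Icc_self hx3⟩
  have hBR : ∀ y ∈ B, ‖y - (x1, x2, x3)‖ ≤ R := by
    rintro ⟨y1, y2, y3⟩ ⟨⟨h1, h1'⟩, ⟨h2, h2'⟩, ⟨h3, h3'⟩⟩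
    obtain ⟨g1, g1'⟩ := hx1
    obtain ⟨g2, g2'⟩ := hx2
    obtain ⟨g3, g3'⟩ := hx3
    dsimp only at h1 h1' h2 h2' h3 h3'
    simp only [Prod.mk_sub_mk, Prod.norm_mk, Real.norm_eq_abs, sup_le_iff, abs_le]
    refine ⟨⟨?_, ?_⟩, ⟨?_, ?_⟩, ⟨?_, ?_⟩⟩ <;> linarith
  have hHaar2 : (volume : Measure (ℝ × ℝ)).IsAddHaarMeasure :=
    inferInstanceAs ((volume : Measure ℝ).prod (volume : Measure ℝ)).IsAddHaarMeasure
  have hHaar3 : (volume : Measure (ℝ × ℝ × ℝ)).IsAddHaarMeasure :=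
    inferInstanceAs ((volume : Measure ℝ).prod (volume : Measure (ℝ × ℝ))).IsAddHaarMeasure
  have hmean := hf.abs_measureReal_mul_sub_setIntegral_le volume (by simp) hB
    ((convex_Icc 0 L).prod ((convex_Icc 0 L).prod (convex_Icc hs h))) hxB hBR
  have hcs := integral_le_sqrt_mul_sqrt (μ := volume.restrict B) (g := fun p => ‖fderiv ℝ F p‖)
    (hf.continuous_norm_fderiv.continuousOn.integrableOn_compact hB)
    ((hf.continuous_norm_fderiv.pow 2).continuousOn.integrableOn_compact hB)
  rw [measureReal_restrict_apply_univ] at hcs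
  rw [hBvol] at hmean hcs
  generalize (∫ y1 in (0:ℝ)..L, ∫ y2 in (0:ℝ)..L, F (y1, y2, hs)) = A at htrace ⊢
  generalize (∫ y1 in (0:ℝ)..L, ∫ y2 in (0:ℝ)..L, ∫ y3 in hs..h, (_ : ℝ)) = G at hgrad ⊢
  generalize (∫ y1 in (0:ℝ)..L, ∫ y2 in (0:ℝ)..L, ∫ y3 in hs..h, (_ : ℝ)) = H at hhess ⊢
  generalize (∫ y in B, ‖fderiv ℝ F y‖) = a at hmean hcs htrace
  set V := L ^ 2 * (h - hs) with hVdef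
  have hG : √(∫ y in B, ‖fderiv ℝ F y‖ ^ 2) ≤ 2 * √G := by
    refine (Real.sqrt_le_sqrt hgrad).trans ?_
    rw [Real.sqrt_mul (by norm_num)]
    gcongr
    exact Real.sqrt_le_iff.2 (by norm_num)
  have hH : √(∫ y in B, ‖fderiv ℝ (fderiv ℝ F) y‖ ^ 2) ≤ 3 * √H := by
    refine (Real.sqrt_le_sqrt hhess).trans ?_
    rw [Real.sqrt_mul (by norm_num)]
    gcongr
    exact Real.sqrt_le_iff.2 (by norm_num)
  have ha : a ≤ √V * (2 * √G) := hcs.trans (by gcongr)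
  have hdR : h - hs ≤ R := by linarith
  have hsum : |V * (F (x1, x2, x3) - 1 / L ^ 2 * A)| ≤
      R * (√V * (2 * √G)) + 2 * R ^ 2 * √V * (3 * √H) + R * (√V * (2 * √G)) := by
    have e : V * (F (x1, x2, x3) - 1 / L ^ 2 * A)
        = (V * F (x1, x2, x3) - ∫ y in B, F y) + ((∫ y in B, F y) - (h - hs) * A) := by
      rw [hVdef]
      field_simp
      ring
    rw [e]
    refine (abs_add_le _ _).trans (add_le_add (hmean.trans ?_) (htrace.trans ?_))
    · gcongr
    · calc (h - hs) * a ≤ (h - hs) * (√V * (2 * √G)) := by gcongr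
        _ ≤ _ := by gcongr
  rw [abs_mul, abs_of_pos hV] at hsum
  have hsV : 0 < √V := Real.sqrt_pos.2 hV
  have hVV : √V * √V = V := Real.mul_self_sqrt hV.le
  rw [div_mul_eq_mul_div (4 * R + 6 * R ^ 2), le_div_iff₀ hsV]
  refine le_of_mul_le_mul_left ?_ hsV
  have hG0 := Real.sqrt_nonneg G
  have hH0 := Real.sqrt_nonneg H
  calc √V * (|F (x1, x2, x3) - 1 / L ^ 2 * A| * √V)
      = √V * √V * |F (x1, x2, x3) - 1 / L ^ 2 * A| := by ring
    _ = V * |F (x1, x2, x3) - 1 / L ^ 2 * A| := by rw [hVV]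
    _ ≤ _ := hsum
    _ = √V * (4 * R * √G + 6 * R ^ 2 * √H) := by ring
    _ ≤ √V * ((4 * R + 6 * R ^ 2) * (√G + √H)) := by
        gcongr
        nlinarith [mul_nonneg hR0.le hH0, mul_nonneg (sq_nonneg R) hG0]
end

section
/- Let u be as in the 3D wave setup (u is C² on closure(Ω_0^s) × [0,T], horizontally periodic, ∂_t²u = λΔu in Ω_0^s × [0,T], and u(x₁,x₂,0,t) = 0). Then 2·(∫_{Ω_0^s} ∂_t u(x,T)·∂₃u(x,T)·x₃ dx − ∫_{Ω_0^s} ∂_t u(x,0)·∂₃u(x,0)·x₃ dx) = h_s·∫₀^T∫_{(0,L)²} ((∂_t u)² + λ(∂₃u)² − λ((∂₁u)² + (∂₂u)²))(x₁,x₂,h_s,t) dx₁dx₂ dt − ∫₀^T∫_{Ω_0^s} ((∂_t u)² + λ(∂₃u)² − λ((∂₁u)² + (∂₂u)²)) dx dt. -/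
/-- Partial derivative in the first spatial variable of `u(x1,x2,x3,t)`. -/
noncomputable def q1 (u : ℝ → ℝ → ℝ → ℝ → ℝ) (x1 x2 x3 t : ℝ) : ℝ :=
  deriv (fun s => u s x2 x3 t) x1

/-- Partial derivative in the second spatial variable of `u(x1,x2,x3,t)`. -/
noncomputable def q2 (u : ℝ → ℝ → ℝ → ℝ → ℝ) (x1 x2 x3 t : ℝ) : ℝ :=
  deriv (fun s => u x1 s x3 t) x2

/-- Partial derivative in the third (vertical) spatial variable of `u(x1,x2,x3,t)`. -/
noncomputable def q3 (u : ℝ → ℝ → ℝ → ℝ → ℝ) (x1 x2 x3 t : ℝ) : ℝ :=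
  deriv (fun s => u x1 x2 s t) x3

/-- Partial derivative in time of `u(x1,x2,x3,t)`. -/
noncomputable def qt (u : ℝ → ℝ → ℝ → ℝ → ℝ) (x1 x2 x3 t : ℝ) : ℝ :=
  deriv (fun s => u x1 x2 x3 s) t

section PartialDerivatives

variable {g : ℝ → ℝ → ℝ → ℝ → ℝ}

theorem hasDerivAt_q1 (hg : ContDiff ℝ 1 ↿g) (a b c d : ℝ) :
    HasDerivAt (fun s => g s b c d) (q1 g a b c d) a := by
  have h : ContDiff ℝ 1 fun s => g s b c d := by fun_prop
  exact (h.differentiable one_ne_zero a).hasDerivAt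

theorem hasDerivAt_q2 (hg : ContDiff ℝ 1 ↿g) (a b c d : ℝ) :
    HasDerivAt (fun s => g a s c d) (q2 g a b c d) b := by
  have h : ContDiff ℝ 1 fun s => g a s c d := by fun_prop
  exact (h.differentiable one_ne_zero b).hasDerivAt

theorem hasDerivAt_q3 (hg : ContDiff ℝ 1 ↿g) (a b c d : ℝ) :
    HasDerivAt (fun s => g a b s d) (q3 g a b c d) c := by
  have h : ContDiff ℝ 1 fun s => g a b s d := by fun_prop
  exact (h.differentiable one_ne_zero c).hasDerivAt

theorem hasDerivAt_qt (hg : ContDiff ℝ 1 ↿g) (a b c d : ℝ) :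
    HasDerivAt (fun s => g a b c s) (qt g a b c d) d := by
  have h : ContDiff ℝ 1 fun s => g a b c s := by fun_prop
  exact (h.differentiable one_ne_zero d).hasDerivAt

theorem uncurry_q1 (hg : ContDiff ℝ 1 ↿g) :
    ↿(q1 g) = fun p => fderiv ℝ ↿g p (1, 0, 0, 0) := by
  funext ⟨a, b, c, d⟩
  exact (((hg.differentiable one_ne_zero) (a, b, c, d)).hasFDerivAt.comp_hasDerivAt a
    ((hasDerivAt_id a).prodMk (hasDerivAt_const a (b, c, d)))).deriv

theorem uncurry_q2 (hg : ContDiff ℝ 1 ↿g) :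
    ↿(q2 g) = fun p => fderiv ℝ ↿g p (0, 1, 0, 0) := by
  funext ⟨a, b, c, d⟩
  exact (((hg.differentiable one_ne_zero) (a, b, c, d)).hasFDerivAt.comp_hasDerivAt b
    ((hasDerivAt_const b a).prodMk
      ((hasDerivAt_id b).prodMk (hasDerivAt_const b (c, d))))).deriv

theorem uncurry_q3 (hg : ContDiff ℝ 1 ↿g) :
    ↿(q3 g) = fun p => fderiv ℝ ↿g p (0, 0, 1, 0) := by
  funext ⟨a, b, c, d⟩
  exact (((hg.differentiable one_ne_zero) (a, b, c, d)).hasFDerivAt.comp_hasDerivAt c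
    ((hasDerivAt_const c a).prodMk ((hasDerivAt_const c b).prodMk
      ((hasDerivAt_id c).prodMk (hasDerivAt_const c d))))).deriv

theorem uncurry_qt (hg : ContDiff ℝ 1 ↿g) :
    ↿(qt g) = fun p => fderiv ℝ ↿g p (0, 0, 0, 1) := by
  funext ⟨a, b, c, d⟩
  exact (((hg.differentiable one_ne_zero) (a, b, c, d)).hasFDerivAt.comp_hasDerivAt d
    ((hasDerivAt_const d a).prodMk ((hasDerivAt_const d b).prodMk
      ((hasDerivAt_const d c).prodMk (hasDerivAt_id d))))).deriv

theorem contDiff_fderiv_apply {E : Type*} [NormedAddCommGroup E] [NormedSpace ℝ E] {F : E → ℝ}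
    {n m : WithTop ℕ∞} (hF : ContDiff ℝ n F) (hmn : m + 1 ≤ n) (v : E) :
    ContDiff ℝ m fun p => fderiv ℝ F p v :=
  (hF.fderiv_right hmn).clm_apply contDiff_const

theorem fderiv_fderiv_apply_comm {E : Type*} [NormedAddCommGroup E] [NormedSpace ℝ E] {F : E → ℝ}
    (hF : ContDiff ℝ 2 F) (v w p : E) :
    fderiv ℝ (fun q => fderiv ℝ F q v) p w = fderiv ℝ (fun q => fderiv ℝ F q w) p v := by
  have hd : DifferentiableAt ℝ (fderiv ℝ F) p :=
    (hF.fderiv_right (m := 1) (by norm_num)).differentiable one_ne_zero p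
  have hs : IsSymmSndFDerivAt ℝ F p := hF.contDiffAt.isSymmSndFDerivAt (by simp)
  rw [fderiv_clm_apply hd (differentiableAt_const v), fderiv_clm_apply hd (differentiableAt_const w)]
  simpa using hs w v

variable {n m : WithTop ℕ∞}

theorem contDiff_q1 (hg : ContDiff ℝ n ↿g) (hmn : m + 1 ≤ n) : ContDiff ℝ m ↿(q1 g) := by
  rw [uncurry_q1 (hg.of_le (le_add_self.trans hmn))]
  exact contDiff_fderiv_apply hg hmn _

theorem contDiff_q2 (hg : ContDiff ℝ n ↿g) (hmn : m + 1 ≤ n) : ContDiff ℝ m ↿(q2 g) := by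
  rw [uncurry_q2 (hg.of_le (le_add_self.trans hmn))]
  exact contDiff_fderiv_apply hg hmn _

theorem contDiff_q3 (hg : ContDiff ℝ n ↿g) (hmn : m + 1 ≤ n) : ContDiff ℝ m ↿(q3 g) := by
  rw [uncurry_q3 (hg.of_le (le_add_self.trans hmn))]
  exact contDiff_fderiv_apply hg hmn _

theorem contDiff_qt (hg : ContDiff ℝ n ↿g) (hmn : m + 1 ≤ n) : ContDiff ℝ m ↿(qt g) := by
  rw [uncurry_qt (hg.of_le (le_add_self.trans hmn))]
  exact contDiff_fderiv_apply hg hmn _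

theorem q1_q3_comm (hg : ContDiff ℝ 2 ↿g) (a b c d : ℝ) :
    q1 (q3 g) a b c d = q3 (q1 g) a b c d := by
  have hg1 : ContDiff ℝ 1 ↿g := hg.of_le one_le_two
  have e1 := congrFun (uncurry_q1 (contDiff_q3 hg (m := 1) (by norm_num))) (a, b, c, d)
  have e3 := congrFun (uncurry_q3 (contDiff_q1 hg (m := 1) (by norm_num))) (a, b, c, d)
  rw [uncurry_q3 hg1] at e1
  rw [uncurry_q1 hg1] at e3
  exact e1.trans ((fderiv_fderiv_apply_comm hg _ _ _).trans e3.symm)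

theorem q2_q3_comm (hg : ContDiff ℝ 2 ↿g) (a b c d : ℝ) :
    q2 (q3 g) a b c d = q3 (q2 g) a b c d := by
  have hg1 : ContDiff ℝ 1 ↿g := hg.of_le one_le_two
  have e2 := congrFun (uncurry_q2 (contDiff_q3 hg (m := 1) (by norm_num))) (a, b, c, d)
  have e3 := congrFun (uncurry_q3 (contDiff_q2 hg (m := 1) (by norm_num))) (a, b, c, d)
  rw [uncurry_q3 hg1] at e2
  rw [uncurry_q2 hg1] at e3
  exact e2.trans ((fderiv_fderiv_apply_comm hg _ _ _).trans e3.symm)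

theorem qt_q3_comm (hg : ContDiff ℝ 2 ↿g) (a b c d : ℝ) :
    qt (q3 g) a b c d = q3 (qt g) a b c d := by
  have hg1 : ContDiff ℝ 1 ↿g := hg.of_le one_le_two
  have et := congrFun (uncurry_qt (contDiff_q3 hg (m := 1) (by norm_num))) (a, b, c, d)
  have e3 := congrFun (uncurry_q3 (contDiff_qt hg (m := 1) (by norm_num))) (a, b, c, d)
  rw [uncurry_q3 hg1] at et
  rw [uncurry_qt hg1] at e3
  exact et.trans ((fderiv_fderiv_apply_comm hg _ _ _).trans e3.symm)

theorem q1_add_period {L : ℝ}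
    (h1 : ∀ a b c d, g (a + L) b c d = g a b c d) (a b c d : ℝ) :
    q1 g (a + L) b c d = q1 g a b c d := by
  simp only [q1]
  rw [← deriv_comp_add_const]
  simp only [h1]

theorem q3_add_period_left {L : ℝ}
    (h1 : ∀ a b c d, g (a + L) b c d = g a b c d) (a b c d : ℝ) :
    q3 g (a + L) b c d = q3 g a b c d := by
  simp only [q3, h1]

theorem q2_add_period {L : ℝ}
    (h2 : ∀ a b c d, g a (b + L) c d = g a b c d) (a b c d : ℝ) :
    q2 g a (b + L) c d = q2 g a b c d := by
  simp only [q2]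
  rw [← deriv_comp_add_const]
  simp only [h2]

theorem q3_add_period_right {L : ℝ}
    (h2 : ∀ a b c d, g a (b + L) c d = g a b c d) (a b c d : ℝ) :
    q3 g a (b + L) c d = q3 g a b c d := by
  simp only [q3, h2]

end PartialDerivatives

section IteratedIntegrals

variable {g f : ℝ → ℝ → ℝ → ℝ → ℝ} {L h T : ℝ}

theorem intervalIntegral_swap_of_continuous {f : ℝ → ℝ → ℝ} (hf : Continuous ↿f) (a b c d : ℝ) :
    ∫ x in a..b, ∫ y in c..d, f x y = ∫ y in c..d, ∫ x in a..b, f x y := by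
  apply MeasureTheory.intervalIntegral_intervalIntegral_swap
  have hf' : Continuous f.uncurry := hf
  exact (hf'.continuousOn.integrableOn_compact
    (isCompact_uIcc.prod isCompact_uIcc)).mono_set
      (Set.prod_mono Set.uIoc_subset_uIcc Set.uIoc_subset_uIcc)

/-- The integral of `g` over the space-time cylinder `(0,L)² × (0,h) × (0,T)`. -/
noncomputable def cylinderIntegral (L h T : ℝ) (g : ℝ → ℝ → ℝ → ℝ → ℝ) : ℝ :=
  ∫ t in (0:ℝ)..T, ∫ x1 in (0:ℝ)..L, ∫ x2 in (0:ℝ)..L, ∫ x3 in (0:ℝ)..h, g x1 x2 x3 t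

theorem cylinderIntegral_add (hg : Continuous ↿g) (hf : Continuous ↿f) :
    cylinderIntegral L h T (fun a b c d => g a b c d + f a b c d)
      = cylinderIntegral L h T g + cylinderIntegral L h T f := by
  have e3 (t x1 x2 : ℝ) : ∫ x3 in (0:ℝ)..h, (g x1 x2 x3 t + f x1 x2 x3 t)
      = (∫ x3 in (0:ℝ)..h, g x1 x2 x3 t) + ∫ x3 in (0:ℝ)..h, f x1 x2 x3 t :=
    intervalIntegral.integral_add (Continuous.intervalIntegrable (by fun_prop) _ _)
      (Continuous.intervalIntegrable (by fun_prop) _ _)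
  have e2 (t x1 : ℝ) : ∫ x2 in (0:ℝ)..L,
        ((∫ x3 in (0:ℝ)..h, g x1 x2 x3 t) + ∫ x3 in (0:ℝ)..h, f x1 x2 x3 t)
      = (∫ x2 in (0:ℝ)..L, ∫ x3 in (0:ℝ)..h, g x1 x2 x3 t)
        + ∫ x2 in (0:ℝ)..L, ∫ x3 in (0:ℝ)..h, f x1 x2 x3 t :=
    intervalIntegral.integral_add (Continuous.intervalIntegrable (by fun_prop) _ _)
      (Continuous.intervalIntegrable (by fun_prop) _ _)
  have e1 (t : ℝ) : ∫ x1 in (0:ℝ)..L, ((∫ x2 in (0:ℝ)..L, ∫ x3 in (0:ℝ)..h, g x1 x2 x3 t)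
        + ∫ x2 in (0:ℝ)..L, ∫ x3 in (0:ℝ)..h, f x1 x2 x3 t)
      = (∫ x1 in (0:ℝ)..L, ∫ x2 in (0:ℝ)..L, ∫ x3 in (0:ℝ)..h, g x1 x2 x3 t)
        + ∫ x1 in (0:ℝ)..L, ∫ x2 in (0:ℝ)..L, ∫ x3 in (0:ℝ)..h, f x1 x2 x3 t :=
    intervalIntegral.integral_add (Continuous.intervalIntegrable (by fun_prop) _ _)
      (Continuous.intervalIntegrable (by fun_prop) _ _)
  simp only [cylinderIntegral, e3, e2, e1]
  exact intervalIntegral.integral_add (Continuous.intervalIntegrable (by fun_prop) _ _)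
      (Continuous.intervalIntegrable (by fun_prop) _ _)

theorem cylinderIntegral_const_mul (k : ℝ) :
    cylinderIntegral L h T (fun a b c d => k * g a b c d) = k * cylinderIntegral L h T g := by
  simp only [cylinderIntegral, intervalIntegral.integral_const_mul]

theorem cylinderIntegral_congr (hL : 0 ≤ L) (hh : 0 ≤ h) (hT : 0 ≤ T)
    (hfg : ∀ x1 ∈ Set.Ioo (0:ℝ) L, ∀ x2 ∈ Set.Ioo (0:ℝ) L, ∀ x3 ∈ Set.Ioo (0:ℝ) h,
      ∀ t ∈ Set.Ioo (0:ℝ) T, f x1 x2 x3 t = g x1 x2 x3 t) :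
    cylinderIntegral L h T f = cylinderIntegral L h T g := by
  refine intervalIntegral.integral_congr_Ioo_of_le hT fun t ht => ?_
  refine intervalIntegral.integral_congr_Ioo_of_le hL fun x1 h1 => ?_
  refine intervalIntegral.integral_congr_Ioo_of_le hL fun x2 h2 => ?_
  exact intervalIntegral.integral_congr_Ioo_of_le hh fun x3 h3 => hfg x1 h1 x2 h2 x3 h3 t ht

theorem cylinderIntegral_q3 (hg : ContDiff ℝ 1 ↿g) (hg0 : ∀ a b d, g a b 0 d = 0) :
    cylinderIntegral L h T (q3 g)
      = ∫ t in (0:ℝ)..T, ∫ x1 in (0:ℝ)..L, ∫ x2 in (0:ℝ)..L, g x1 x2 h t := by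
  have hc : Continuous ↿(q3 g) := (contDiff_q3 hg (m := 0) (by norm_num)).continuous
  have e (x1 x2 t : ℝ) : ∫ x3 in (0:ℝ)..h, q3 g x1 x2 x3 t = g x1 x2 h t := by
    rw [intervalIntegral.integral_eq_sub_of_hasDerivAt (fun x _ => hasDerivAt_q3 hg x1 x2 x t)
      (Continuous.intervalIntegrable (by fun_prop) _ _), hg0, sub_zero]
  simp only [cylinderIntegral, e]

theorem cylinderIntegral_q2 (hg : ContDiff ℝ 1 ↿g) (hper : ∀ a c d, g a L c d = g a 0 c d) :
    cylinderIntegral L h T (q2 g) = 0 := by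
  have hc : Continuous ↿(q2 g) := (contDiff_q2 hg (m := 0) (by norm_num)).continuous
  have e (x1 x3 t : ℝ) : ∫ x2 in (0:ℝ)..L, q2 g x1 x2 x3 t = 0 := by
    rw [intervalIntegral.integral_eq_sub_of_hasDerivAt (fun x _ => hasDerivAt_q2 hg x1 x x3 t)
      (Continuous.intervalIntegrable (by fun_prop) _ _), hper, sub_self]
  have s (x1 t : ℝ) : ∫ x2 in (0:ℝ)..L, ∫ x3 in (0:ℝ)..h, q2 g x1 x2 x3 t = 0 := by
    rw [intervalIntegral_swap_of_continuous (by fun_prop)]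
    simp [e]
  simp [cylinderIntegral, s]

theorem cylinderIntegral_q1 (hg : ContDiff ℝ 1 ↿g) (hper : ∀ b c d, g L b c d = g 0 b c d) :
    cylinderIntegral L h T (q1 g) = 0 := by
  have hc : Continuous ↿(q1 g) := (contDiff_q1 hg (m := 0) (by norm_num)).continuous
  have e (x2 x3 t : ℝ) : ∫ x1 in (0:ℝ)..L, q1 g x1 x2 x3 t = 0 := by
    rw [intervalIntegral.integral_eq_sub_of_hasDerivAt (fun x _ => hasDerivAt_q1 hg x x2 x3 t)
      (Continuous.intervalIntegrable (by fun_prop) _ _), hper, sub_self]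
  have s (x2 t : ℝ) : ∫ x1 in (0:ℝ)..L, ∫ x3 in (0:ℝ)..h, q1 g x1 x2 x3 t = 0 := by
    rw [intervalIntegral_swap_of_continuous (by fun_prop)]
    simp [e]
  have r (t : ℝ) : ∫ x1 in (0:ℝ)..L, ∫ x2 in (0:ℝ)..L, ∫ x3 in (0:ℝ)..h, q1 g x1 x2 x3 t = 0 := by
    rw [intervalIntegral_swap_of_continuous (by fun_prop)]
    simp [s]
  simp [cylinderIntegral, r]

theorem cylinderIntegral_qt (hg : ContDiff ℝ 1 ↿g) :
    cylinderIntegral L h T (qt g)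
      = (∫ x1 in (0:ℝ)..L, ∫ x2 in (0:ℝ)..L, ∫ x3 in (0:ℝ)..h, g x1 x2 x3 T)
        - ∫ x1 in (0:ℝ)..L, ∫ x2 in (0:ℝ)..L, ∫ x3 in (0:ℝ)..h, g x1 x2 x3 0 := by
  have hc : Continuous ↿(qt g) := (contDiff_qt hg (m := 0) (by norm_num)).continuous
  have hg' : Continuous ↿g := hg.continuous
  have e0 (x1 x2 x3 : ℝ) : ∫ t in (0:ℝ)..T, qt g x1 x2 x3 t = g x1 x2 x3 T - g x1 x2 x3 0 :=
    intervalIntegral.integral_eq_sub_of_hasDerivAt (fun x _ => hasDerivAt_qt hg x1 x2 x3 x)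
      (Continuous.intervalIntegrable (by fun_prop) _ _)
  have e3 (x1 x2 : ℝ) : ∫ t in (0:ℝ)..T, ∫ x3 in (0:ℝ)..h, qt g x1 x2 x3 t
      = (∫ x3 in (0:ℝ)..h, g x1 x2 x3 T) - ∫ x3 in (0:ℝ)..h, g x1 x2 x3 0 := by
    rw [intervalIntegral_swap_of_continuous (by fun_prop)]
    simp only [e0]
    exact intervalIntegral.integral_sub (Continuous.intervalIntegrable (by fun_prop) _ _)
      (Continuous.intervalIntegrable (by fun_prop) _ _)
  have e2 (x1 : ℝ) : ∫ t in (0:ℝ)..T, ∫ x2 in (0:ℝ)..L, ∫ x3 in (0:ℝ)..h, qt g x1 x2 x3 t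
      = (∫ x2 in (0:ℝ)..L, ∫ x3 in (0:ℝ)..h, g x1 x2 x3 T)
        - ∫ x2 in (0:ℝ)..L, ∫ x3 in (0:ℝ)..h, g x1 x2 x3 0 := by
    rw [intervalIntegral_swap_of_continuous (by fun_prop)]
    simp only [e3]
    exact intervalIntegral.integral_sub (Continuous.intervalIntegrable (by fun_prop) _ _)
      (Continuous.intervalIntegrable (by fun_prop) _ _)
  rw [cylinderIntegral, intervalIntegral_swap_of_continuous (by fun_prop)]
  simp only [e2]
  exact intervalIntegral.integral_sub (Continuous.intervalIntegrable (by fun_prop) _ _)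
      (Continuous.intervalIntegrable (by fun_prop) _ _)

end IteratedIntegrals

/-- The density `(∂_t u)² + λ(∂₃u)² - λ((∂₁u)² + (∂₂u)²)`. -/
noncomputable def waveDensity (lam : ℝ) (u : ℝ → ℝ → ℝ → ℝ → ℝ) (x1 x2 x3 t : ℝ) : ℝ :=
  (qt u x1 x2 x3 t) ^ 2 + lam * (q3 u x1 x2 x3 t) ^ 2
    - lam * ((q1 u x1 x2 x3 t) ^ 2 + (q2 u x1 x2 x3 t) ^ 2)

theorem contDiff_waveDensity {lam : ℝ} {u : ℝ → ℝ → ℝ → ℝ → ℝ} (hu : ContDiff ℝ 2 ↿u) :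
    ContDiff ℝ 1 ↿(waveDensity lam u) := by
  have c1 : ContDiff ℝ 1 ↿(q1 u) := contDiff_q1 hu (by norm_num)
  have c2 : ContDiff ℝ 1 ↿(q2 u) := contDiff_q2 hu (by norm_num)
  have c3 : ContDiff ℝ 1 ↿(q3 u) := contDiff_q3 hu (by norm_num)
  have ct : ContDiff ℝ 1 ↿(qt u) := contDiff_qt hu (by norm_num)
  exact ((ct.pow 2).add (contDiff_const.mul (c3.pow 2))).sub
    (contDiff_const.mul ((c1.pow 2).add (c2.pow 2)))

/-- Differential form of the multiplier identity: pairing the wave equation with `x₃ ∂₃u` gives a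
space-time divergence. -/
theorem two_mul_qt_multiplier {lam : ℝ} {u : ℝ → ℝ → ℝ → ℝ → ℝ} (hu : ContDiff ℝ 2 ↿u)
    {x1 x2 x3 t : ℝ}
    (hpde : qt (qt u) x1 x2 x3 t
      = lam * (q1 (q1 u) x1 x2 x3 t + q2 (q2 u) x1 x2 x3 t + q3 (q3 u) x1 x2 x3 t)) :
    2 * qt (fun a b c d => qt u a b c d * q3 u a b c d * c) x1 x2 x3 t
        + waveDensity lam u x1 x2 x3 t
      = q3 (fun a b c d => waveDensity lam u a b c d * c) x1 x2 x3 t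
        + (2 * lam * q1 (fun a b c d => q1 u a b c d * q3 u a b c d * c) x1 x2 x3 t
          + 2 * lam * q2 (fun a b c d => q2 u a b c d * q3 u a b c d * c) x1 x2 x3 t) := by
  have c1 : ContDiff ℝ 1 ↿(q1 u) := contDiff_q1 hu (by norm_num)
  have c2 : ContDiff ℝ 1 ↿(q2 u) := contDiff_q2 hu (by norm_num)
  have c3 : ContDiff ℝ 1 ↿(q3 u) := contDiff_q3 hu (by norm_num)
  have ct : ContDiff ℝ 1 ↿(qt u) := contDiff_qt hu (by norm_num)
  have et := (((hasDerivAt_qt ct x1 x2 x3 t).mul (hasDerivAt_qt c3 x1 x2 x3 t)).mul_const x3).deriv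
  have e1 := (((hasDerivAt_q1 c1 x1 x2 x3 t).mul (hasDerivAt_q1 c3 x1 x2 x3 t)).mul_const x3).deriv
  have e2 := (((hasDerivAt_q2 c2 x1 x2 x3 t).mul (hasDerivAt_q2 c3 x1 x2 x3 t)).mul_const x3).deriv
  have e3 := ((((hasDerivAt_q3 ct x1 x2 x3 t).pow 2).add
      (((hasDerivAt_q3 c3 x1 x2 x3 t).pow 2).const_mul lam)).sub
      ((((hasDerivAt_q3 c1 x1 x2 x3 t).pow 2).add
        ((hasDerivAt_q3 c2 x1 x2 x3 t).pow 2)).const_mul lam)).mul (hasDerivAt_id x3) |>.deriv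
  rw [show qt (fun a b c d => qt u a b c d * q3 u a b c d * c) x1 x2 x3 t = _ from et,
    show q1 (fun a b c d => q1 u a b c d * q3 u a b c d * c) x1 x2 x3 t = _ from e1,
    show q2 (fun a b c d => q2 u a b c d * q3 u a b c d * c) x1 x2 x3 t = _ from e2,
    show q3 (fun a b c d => waveDensity lam u a b c d * c) x1 x2 x3 t = _ from e3,
    q1_q3_comm hu, q2_q3_comm hu, qt_q3_comm hu, hpde, waveDensity]
  simp
  ring

/-- multiplier identity obtained by pairing the wave equation
`∂_t²u = λΔu` on `Ω_0^s = (0,L)² × (0,h_s)` (horizontally periodic, Dirichlet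
at the bottom) with `x₃ ∂₃u`. -/
theorem stmt_11 (L hs T lam : ℝ) (hL : 0 < L) (hhs : 0 < hs) (hT : 0 < T) (hlam : 0 < lam)
    (u : ℝ → ℝ → ℝ → ℝ → ℝ)
    (hu : ContDiff ℝ 2 (fun p : ℝ × ℝ × ℝ × ℝ => u p.1 p.2.1 p.2.2.1 p.2.2.2))
    (hper : ∀ x1 x2 x3 t : ℝ,
      u (x1 + L) x2 x3 t = u x1 x2 x3 t ∧ u x1 (x2 + L) x3 t = u x1 x2 x3 t)
    (hpde : ∀ x1 ∈ Set.Ioo (0:ℝ) L, ∀ x2 ∈ Set.Ioo (0:ℝ) L, ∀ x3 ∈ Set.Ioo (0:ℝ) hs,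
      ∀ t ∈ Set.Icc (0:ℝ) T,
      qt (qt u) x1 x2 x3 t
        = lam * (q1 (q1 u) x1 x2 x3 t + q2 (q2 u) x1 x2 x3 t + q3 (q3 u) x1 x2 x3 t))
    (hdir : ∀ x1 x2 : ℝ, ∀ t ∈ Set.Icc (0:ℝ) T, u x1 x2 0 t = 0) :
    2 * ((∫ x1 in (0:ℝ)..L, ∫ x2 in (0:ℝ)..L, ∫ x3 in (0:ℝ)..hs,
            qt u x1 x2 x3 T * q3 u x1 x2 x3 T * x3)
        - ∫ x1 in (0:ℝ)..L, ∫ x2 in (0:ℝ)..L, ∫ x3 in (0:ℝ)..hs,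
            qt u x1 x2 x3 0 * q3 u x1 x2 x3 0 * x3)
      = hs * (∫ t in (0:ℝ)..T, ∫ x1 in (0:ℝ)..L, ∫ x2 in (0:ℝ)..L,
            ((qt u x1 x2 hs t) ^ 2 + lam * (q3 u x1 x2 hs t) ^ 2
              - lam * ((q1 u x1 x2 hs t) ^ 2 + (q2 u x1 x2 hs t) ^ 2)))
        - ∫ t in (0:ℝ)..T, ∫ x1 in (0:ℝ)..L, ∫ x2 in (0:ℝ)..L, ∫ x3 in (0:ℝ)..hs,
            ((qt u x1 x2 x3 t) ^ 2 + lam * (q3 u x1 x2 x3 t) ^ 2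
              - lam * ((q1 u x1 x2 x3 t) ^ 2 + (q2 u x1 x2 x3 t) ^ 2)) := by
  replace hu : ContDiff ℝ 2 ↿u := hu
  have hp1 (a b c d : ℝ) : u (a + L) b c d = u a b c d := (hper a b c d).1
  have hp2 (a b c d : ℝ) : u a (b + L) c d = u a b c d := (hper a b c d).2
  have c1 : ContDiff ℝ 1 ↿(q1 u) := contDiff_q1 hu (by norm_num)
  have c2 : ContDiff ℝ 1 ↿(q2 u) := contDiff_q2 hu (by norm_num)
  have c3 : ContDiff ℝ 1 ↿(q3 u) := contDiff_q3 hu (by norm_num)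
  have ct : ContDiff ℝ 1 ↿(qt u) := contDiff_qt hu (by norm_num)
  have cw : ContDiff ℝ 1 ↿(waveDensity lam u) := contDiff_waveDensity hu
  have cx : ContDiff ℝ 1 fun p : ℝ × ℝ × ℝ × ℝ => p.2.2.1 := by fun_prop
  have k1 : ContDiff ℝ 1 ↿(fun a b c d => q1 u a b c d * q3 u a b c d * c) := (c1.mul c3).mul cx
  have k2 : ContDiff ℝ 1 ↿(fun a b c d => q2 u a b c d * q3 u a b c d * c) := (c2.mul c3).mul cx
  have k3 : ContDiff ℝ 1 ↿(fun a b c d => waveDensity lam u a b c d * c) := cw.mul cx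
  have kt : ContDiff ℝ 1 ↿(fun a b c d => qt u a b c d * q3 u a b c d * c) := (ct.mul c3).mul cx
  have m1 := (contDiff_q1 k1 (m := 0) (by norm_num)).continuous
  have m2 := (contDiff_q2 k2 (m := 0) (by norm_num)).continuous
  have m3 := (contDiff_q3 k3 (m := 0) (by norm_num)).continuous
  have mt := (contDiff_qt kt (m := 0) (by norm_num)).continuous
  have key := cylinderIntegral_congr hL.le hhs.le hT.le fun x1 h1 x2 h2 x3 h3 t ht =>
    two_mul_qt_multiplier hu (hpde x1 h1 x2 h2 x3 h3 t ⟨ht.1.le, ht.2.le⟩)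
  have per1 (b c d : ℝ) : q1 u L b c d * q3 u L b c d * c = q1 u 0 b c d * q3 u 0 b c d * c := by
    have e1 := q1_add_period hp1 0 b c d
    have e3 := q3_add_period_left hp1 0 b c d
    rw [zero_add] at e1 e3
    rw [e1, e3]
  have per2 (a c d : ℝ) : q2 u a L c d * q3 u a L c d * c = q2 u a 0 c d * q3 u a 0 c d * c := by
    have e2 := q2_add_period hp2 a 0 c d
    have e3 := q3_add_period_right hp2 a 0 c d
    rw [zero_add] at e2 e3
    rw [e2, e3]
  rw [cylinderIntegral_add (continuous_const.mul mt) cw.continuous,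
    cylinderIntegral_add m3 ((continuous_const.mul m1).add (continuous_const.mul m2)),
    cylinderIntegral_add (continuous_const.mul m1) (continuous_const.mul m2),
    cylinderIntegral_const_mul, cylinderIntegral_const_mul, cylinderIntegral_const_mul,
    cylinderIntegral_q1 k1 per1, cylinderIntegral_q2 k2 per2,
    cylinderIntegral_q3 k3 fun _ _ _ => mul_zero _, cylinderIntegral_qt kt] at key
  simp only [intervalIntegral.integral_mul_const] at key
  change _ = hs * (∫ t in (0:ℝ)..T, ∫ x1 in (0:ℝ)..L, ∫ x2 in (0:ℝ)..L, waveDensity lam u x1 x2 hs t)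
    - cylinderIntegral L hs T (waveDensity lam u)
  linear_combination key
end

section
/- Let λ > 0, g ∈ ℝ, and define φ_e : [0,h_s] → ℝ by φ_e(x₃) = (g/(2λ))·x₃·(x₃ − h_s). Let φ be a C² function on the closure of Ω_0^s, horizontally periodic, with φ(x₁,x₂,0) = 0 for all (x₁,x₂). Then ∫_{Ω_0^s} ((λ/2)|∇φ|² + g·φ) dx = ∫_{Ω_0^s} (λ/2)|∇(φ − φ_e)|² dx + (g·h_s/2)·∫_{(0,L)²} φ(x₁,x₂,h_s) dx₁dx₂ + ∫_{Ω_0^s} ((λ/2)·(φ_e'(x₃))² + g·φ_e(x₃)) dx, where φ − φ_e denotes the function x ↦ φ(x) − φ_e(x₃). -/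
/-- Integrating in the third variable preserves joint continuity in all variables. -/
theorem continuous_integral_third {f : ℝ → ℝ → ℝ → ℝ}
    (hf : Continuous fun p : ℝ × ℝ × ℝ => f p.1 p.2.1 p.2.2) (a b : ℝ) :
    Continuous fun p : ℝ × ℝ => ∫ x3 in a..b, f p.1 p.2 x3 := by
  refine intervalIntegral.continuous_parametric_intervalIntegral_of_continuous'
    (f := fun (p : ℝ × ℝ) x3 => f p.1 p.2 x3) ?_ a b
  exact hf.comp (f := fun q : (ℝ × ℝ) × ℝ => (q.1.1, q.1.2, q.2)) (by fun_prop)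

/-- The integral of a linear combination of continuous functions and a constant function. -/
theorem integral_add_const_mul_add {f g : ℝ → ℝ} (hf : Continuous f) (hg : Continuous g)
    (a b k D : ℝ) :
    (∫ x in a..b, (f x + k * g x + D))
      = (∫ x in a..b, f x) + k * (∫ x in a..b, g x) + ∫ _x in a..b, D := by
  rw [← intervalIntegral.integral_const_mul, ← intervalIntegral.integral_add,
    ← intervalIntegral.integral_add]
  all_goals exact Continuous.intervalIntegrable (by fun_prop) _ _

/-- The double integral of a linear combination of continuous functions and a constant function. -/
theorem integral_integral_add_const_mul_add {B C : ℝ → ℝ → ℝ}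
    (hB : Continuous fun p : ℝ × ℝ => B p.1 p.2) (hC : Continuous fun p : ℝ × ℝ => C p.1 p.2)
    (a b c d k D : ℝ) :
    (∫ x in a..b, ∫ y in c..d, (B x y + k * C x y + D))
      = (∫ x in a..b, ∫ y in c..d, B x y) + k * (∫ x in a..b, ∫ y in c..d, C x y)
        + ∫ _x in a..b, ∫ _y in c..d, D := by
  have hBy (x : ℝ) : Continuous (B x) :=
    hB.comp (f := fun y : ℝ => (x, y)) (by fun_prop)
  have hCy (x : ℝ) : Continuous (C x) :=
    hC.comp (f := fun y : ℝ => (x, y)) (by fun_prop)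
  have hBi : Continuous fun x => ∫ y in c..d, B x y :=
    intervalIntegral.continuous_parametric_intervalIntegral_of_continuous' hB c d
  have hCi : Continuous fun x => ∫ y in c..d, C x y :=
    intervalIntegral.continuous_parametric_intervalIntegral_of_continuous' hC c d
  simp_rw [fun x => integral_add_const_mul_add (hBy x) (hCy x) c d k D]
  exact integral_add_const_mul_add hBi hCi a b k _

section PartialDerivatives

variable {f : ℝ → ℝ → ℝ → ℝ}

theorem continuous_pd1 (hf : ContDiff ℝ 1 fun p : ℝ × ℝ × ℝ => f p.1 p.2.1 p.2.2) :
    Continuous fun p : ℝ × ℝ × ℝ => pd1 f p.1 p.2.1 p.2.2 := by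
  have key (p : ℝ × ℝ × ℝ) : pd1 f p.1 p.2.1 p.2.2
      = fderiv ℝ (fun p : ℝ × ℝ × ℝ => f p.1 p.2.1 p.2.2) p (1, 0, 0) :=
    ((hf.differentiable one_ne_zero p).hasFDerivAt.comp_hasDerivAt_of_eq p.1
      ((hasDerivAt_id p.1).prodMk
        ((hasDerivAt_const p.1 p.2.1).prodMk (hasDerivAt_const p.1 p.2.2))) rfl).deriv
  simp_rw [key]
  exact (hf.continuous_fderiv one_ne_zero).clm_apply continuous_const

theorem continuous_pd2 (hf : ContDiff ℝ 1 fun p : ℝ × ℝ × ℝ => f p.1 p.2.1 p.2.2) :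
    Continuous fun p : ℝ × ℝ × ℝ => pd2 f p.1 p.2.1 p.2.2 := by
  have key (p : ℝ × ℝ × ℝ) : pd2 f p.1 p.2.1 p.2.2
      = fderiv ℝ (fun p : ℝ × ℝ × ℝ => f p.1 p.2.1 p.2.2) p (0, 1, 0) :=
    ((hf.differentiable one_ne_zero p).hasFDerivAt.comp_hasDerivAt_of_eq p.2.1
      ((hasDerivAt_const p.2.1 p.1).prodMk
        ((hasDerivAt_id p.2.1).prodMk (hasDerivAt_const p.2.1 p.2.2))) rfl).deriv
  simp_rw [key]
  exact (hf.continuous_fderiv one_ne_zero).clm_apply continuous_const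

theorem continuous_pd3 (hf : ContDiff ℝ 1 fun p : ℝ × ℝ × ℝ => f p.1 p.2.1 p.2.2) :
    Continuous fun p : ℝ × ℝ × ℝ => pd3 f p.1 p.2.1 p.2.2 := by
  have key (p : ℝ × ℝ × ℝ) : pd3 f p.1 p.2.1 p.2.2
      = fderiv ℝ (fun p : ℝ × ℝ × ℝ => f p.1 p.2.1 p.2.2) p (0, 0, 1) :=
    ((hf.differentiable one_ne_zero p).hasFDerivAt.comp_hasDerivAt_of_eq p.2.2
      ((hasDerivAt_const p.2.2 p.1).prodMk
        ((hasDerivAt_const p.2.2 p.2.1).prodMk (hasDerivAt_id p.2.2))) rfl).deriv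
  simp_rw [key]
  exact (hf.continuous_fderiv one_ne_zero).clm_apply continuous_const

theorem hasDerivAt_pd3 (hf : ContDiff ℝ 1 fun p : ℝ × ℝ × ℝ => f p.1 p.2.1 p.2.2)
    (x1 x2 x3 : ℝ) : HasDerivAt (f x1 x2) (pd3 f x1 x2 x3) x3 := by
  have h : Differentiable ℝ (f x1 x2) :=
    (hf.differentiable one_ne_zero).comp (f := fun s : ℝ => (x1, x2, s)) (by fun_prop)
  exact (h x3).hasDerivAt

end PartialDerivatives

/-- the elastic-plus-gravitational energy in the solid box
`Ω_0^s = (0,L)² × (0,h_s)` equals the elastic energy of the perturbation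
`φ − φ_e` around the equilibrium `φ_e(x₃) = (g/(2λ)) x₃(x₃ − h_s)`, plus an
interface term and a constant. -/
theorem stmt_16 (L hs lam g : ℝ) (hL : 0 < L) (hhs : 0 < hs) (hlam : 0 < lam)
    (phie : ℝ → ℝ) (hphie : ∀ s : ℝ, phie s = g / (2 * lam) * (s * (s - hs)))
    (phi : ℝ → ℝ → ℝ → ℝ)
    (hphi : ContDiff ℝ 2 (fun p : ℝ × ℝ × ℝ => phi p.1 p.2.1 p.2.2))
    (hper : ∀ x1 x2 x3 : ℝ,
      phi (x1 + L) x2 x3 = phi x1 x2 x3 ∧ phi x1 (x2 + L) x3 = phi x1 x2 x3)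
    (hbot : ∀ x1 x2 : ℝ, phi x1 x2 0 = 0) :
    (∫ x1 in (0:ℝ)..L, ∫ x2 in (0:ℝ)..L, ∫ x3 in (0:ℝ)..hs,
        ((lam / 2) * ((pd1 phi x1 x2 x3) ^ 2 + (pd2 phi x1 x2 x3) ^ 2
            + (pd3 phi x1 x2 x3) ^ 2)
          + g * phi x1 x2 x3))
      = (∫ x1 in (0:ℝ)..L, ∫ x2 in (0:ℝ)..L, ∫ x3 in (0:ℝ)..hs,
          (lam / 2) * ((pd1 phi x1 x2 x3) ^ 2 + (pd2 phi x1 x2 x3) ^ 2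
            + (pd3 phi x1 x2 x3 - deriv phie x3) ^ 2))
        + (g * hs / 2) * (∫ x1 in (0:ℝ)..L, ∫ x2 in (0:ℝ)..L, phi x1 x2 hs)
        + ∫ x1 in (0:ℝ)..L, ∫ x2 in (0:ℝ)..L, ∫ x3 in (0:ℝ)..hs,
            ((lam / 2) * (deriv phie x3) ^ 2 + g * phie x3) := by
  have hder (s : ℝ) : HasDerivAt phie (g / (2 * lam) * (2 * s - hs)) s := by
    rw [funext hphie]
    refine (((hasDerivAt_id s).mul ((hasDerivAt_id s).sub_const hs)).const_mul
      (g / (2 * lam))).congr_deriv ?_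
    simp only [id]
    ring
  simp_rw [(hder _).deriv]
  have hphi1 := hphi.of_le one_le_two
  have hc1 := continuous_pd1 hphi1
  have hc2 := continuous_pd2 hphi1
  have hc3 := continuous_pd3 hphi1
  have hc0 := hphi.continuous
  have hphie_cont : Continuous phie := continuous_iff_continuousAt.2 fun s => (hder s).continuousAt
  have hB : Continuous fun p : ℝ × ℝ × ℝ =>
      (lam / 2) * ((pd1 phi p.1 p.2.1 p.2.2) ^ 2 + (pd2 phi p.1 p.2.1 p.2.2) ^ 2
        + (pd3 phi p.1 p.2.1 p.2.2 - g / (2 * lam) * (2 * p.2.2 - hs)) ^ 2) := by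
    fun_prop
  have hC : Continuous fun p : ℝ × ℝ => phi p.1 p.2 hs :=
    hc0.comp (f := fun p : ℝ × ℝ => (p.1, p.2, hs)) (by fun_prop)
  rw [← integral_integral_add_const_mul_add (continuous_integral_third
    (f := fun x1 x2 x3 => (lam / 2) * ((pd1 phi x1 x2 x3) ^ 2 + (pd2 phi x1 x2 x3) ^ 2
      + (pd3 phi x1 x2 x3 - g / (2 * lam) * (2 * x3 - hs)) ^ 2)) hB 0 hs) hC]
  congr! 5 with x1 x2
  have hline : Continuous fun s : ℝ => (x1, x2, s) := by fun_prop
  have hl0 : Continuous fun s => phi x1 x2 s := hc0.comp hline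
  have hl1 : Continuous fun s => pd1 phi x1 x2 s := hc1.comp hline
  have hl2 : Continuous fun s => pd2 phi x1 x2 s := hc2.comp hline
  have hl3 : Continuous fun s => pd3 phi x1 x2 s := hc3.comp hline
  have hflux (s : ℝ) : HasDerivAt
      (fun s => lam * (phi x1 x2 s - phie s) * (g / (2 * lam) * (2 * s - hs)))
      (lam * (pd3 phi x1 x2 s - g / (2 * lam) * (2 * s - hs)) * (g / (2 * lam) * (2 * s - hs))
        + g * (phi x1 x2 s - phie s)) s := by
    refine ((((hasDerivAt_pd3 hphi1 x1 x2 s).sub (hder s)).const_mul lam).mul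
      ((((hasDerivAt_id s).const_mul 2).sub_const hs).const_mul (g / (2 * lam)))).congr_deriv ?_
    simp only [id, Pi.sub_apply]
    field_simp
  have hFTC := intervalIntegral.integral_eq_sub_of_hasDerivAt (a := 0) (b := hs)
    (fun s _ => hflux s) (Continuous.intervalIntegrable (by fun_prop) _ _)
  have hval : g * hs / 2 * phi x1 x2 hs
      = lam * (phi x1 x2 hs - phie hs) * (g / (2 * lam) * (2 * hs - hs))
        - lam * (phi x1 x2 0 - phie 0) * (g / (2 * lam) * (2 * 0 - hs)) := by
    rw [hbot, hphie, hphie]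
    field_simp
    ring
  rw [hval, ← hFTC, ← intervalIntegral.integral_add, ← intervalIntegral.integral_add]
  · congr with s
    ring
  all_goals exact Continuous.intervalIntegrable (by fun_prop) _ _
end
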